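/- arXiv:0807.0798 — 5 statements merged into one kernel-verified Lean document; each statement's English description precedes it below -/
import Mathlib

section
/- Let r ≥ 1. Every conjugation-invariant polynomial function on SL(3,ℂ)^r lies in the ℂ-subalgebra of functions SL(3,ℂ)^r → ℂ generated by the trace functions (X₁,…,X_r) ↦ tr(M₁M₂⋯M_l), where 1 ≤ l ≤ 6 and each letter M_j is one of X₁,…,X_r or one of X₁⁻¹,…,X_r⁻¹; that is, traces of words of length at most 6 in the matrices and their inverses generate all conjugation-invariant polynomial functions on SL(3,ℂ)^r. -/
/-- `SL(3,ℂ)`. -/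
abbrev SL3 := Matrix.SpecialLinearGroup (Fin 3) ℂ


section NilRing
variable {N : Type*} [NonUnitalRing N]

/-- The full polarisation of `x ^ 3`. -/
def polCube (a b c : N) : N :=
  a * b * c + a * c * b + b * a * c + b * c * a + c * a * b + c * b * a


lemma nil_sq_mid
    (h : ∀ a b c : N, polCube a b c = 0)
    (tf : ∀ (n : ℕ) (x : N), n ≠ 0 → n • x = 0 → x = 0)
    (x w y : N) : x * x * w * (y * y) = 0 := by
  apply tf 6 _ (by norm_num)
  have e : 6 • (x * x * w * (y * y)) =
      - (polCube (y * y) x x * w) + polCube y (x * x * w) y + x * polCube y y (x * w)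
      - polCube x x y * w * y + x * x * polCube y y w := by
    simp only [polCube]
    noncomm_ring
  rw [e]
  simp [h]

lemma nil_three
    (h : ∀ a b c : N, polCube a b c = 0)
    (tf : ∀ (n : ℕ) (x : N), n ≠ 0 → n • x = 0 → x = 0)
    (x a : N) : x * a * x = - (x * x * a) - a * x * x := by
  have e : 2 • (x * a * x + x * x * a + a * x * x) = polCube x x a := by
    simp only [polCube]
    noncomm_ring
  have := tf 2 _ (by norm_num) (e.trans (h _ _ _))
  have e2 : x * a * x = (x * a * x + x * x * a + a * x * x) - (x * x * a) - a * x * x := by abel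
  rw [e2, this]; abel

lemma nil_mid_pol
    (h : ∀ a b c : N, polCube a b c = 0)
    (tf : ∀ (n : ℕ) (x : N), n ≠ 0 → n • x = 0 → x = 0)
    (x w y z : N) : x * x * w * (y * z) = - (x * x * w * (z * y)) := by
  have h1 := nil_sq_mid h tf x w (y + z)
  have h2 := nil_sq_mid h tf x w y
  have h3 := nil_sq_mid h tf x w z
  have e : x * x * w * ((y + z) * (y + z)) = x * x * w * (y * y) + x * x * w * (z * z)
    + (x * x * w * (y * z) + x * x * w * (z * y)) := by noncomm_ring
  rw [h1, h2, h3] at e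
  simp only [zero_add] at e
  exact eq_neg_of_add_eq_zero_left e.symm

lemma nil_mid_pol'
    (h : ∀ a b c : N, polCube a b c = 0)
    (tf : ∀ (n : ℕ) (x : N), n ≠ 0 → n • x = 0 → x = 0)
    (x w y z : N) : y * z * w * (x * x) = - (z * y * w * (x * x)) := by
  have h1 := nil_sq_mid h tf (y + z) w x
  have h2 := nil_sq_mid h tf y w x
  have h3 := nil_sq_mid h tf z w x
  have e : (y + z) * (y + z) * w * (x * x) = y * y * w * (x * x) + z * z * w * (x * x)
    + (y * z * w * (x * x) + z * y * w * (x * x)) := by noncomm_ring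
  rw [h1, h2, h3] at e
  simp only [zero_add] at e
  exact eq_neg_of_add_eq_zero_left e.symm

lemma nil_self_neg
    (tf : ∀ (n : ℕ) (x : N), n ≠ 0 → n • x = 0 → x = 0)
    (x : N) (hx : x = -x) : x = 0 := by
  apply tf 2 _ (by norm_num)
  rw [two_nsmul]
  nth_rewrite 1 [hx]
  simp

lemma nil_sq_first
    (h : ∀ a b c : N, polCube a b c = 0)
    (tf : ∀ (n : ℕ) (x : N), n ≠ 0 → n • x = 0 → x = 0)
    (x y z w v : N) : x * (x * (y * (z * (w * v)))) = 0 := by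
  apply nil_self_neg tf
  have h1 := nil_mid_pol h tf x y z (w * v)
  have h2 := nil_mid_pol h tf x y z w
  have h3 := nil_mid_pol h tf x (y * w) z v
  have h2' := congrArg (· * v) h2
  simp only [neg_mul, mul_assoc] at h1 h2' h3
  rw [h3, neg_neg] at h2'
  exact h1.trans (by rw [h2'])

lemma nil_sq_last
    (h : ∀ a b c : N, polCube a b c = 0)
    (tf : ∀ (n : ℕ) (x : N), n ≠ 0 → n • x = 0 → x = 0)
    (x y z w v : N) : y * (z * (w * (v * (x * x)))) = 0 := by
  apply nil_self_neg tf
  have h1 := nil_mid_pol' h tf x v (y * z) w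
  have h2 := nil_mid_pol' h tf x v z w
  have h3 := nil_mid_pol' h tf x (z * v) y w
  have h2' := congrArg (y * ·) h2
  simp only [mul_neg, mul_assoc] at h1 h2' h3
  rw [h3, neg_neg] at h2'
  exact h1.trans (by rw [h2'])

lemma nil_pol_first
    (h : ∀ a b c : N, polCube a b c = 0)
    (tf : ∀ (n : ℕ) (x : N), n ≠ 0 → n • x = 0 → x = 0)
    (x s y z w v : N) :
    x * (s * (y * (z * (w * v)))) = - (s * (x * (y * (z * (w * v))))) := by
  have h1 := nil_sq_first h tf (x + s) y z w v
  have h2 := nil_sq_first h tf x y z w v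
  have h3 := nil_sq_first h tf s y z w v
  simp only [add_mul, mul_add, h2, h3, zero_add, add_zero] at h1
  exact eq_neg_of_add_eq_zero_right h1

lemma nil_aux
    (h : ∀ a b c : N, polCube a b c = 0)
    (tf : ∀ (n : ℕ) (x : N), n ≠ 0 → n • x = 0 → x = 0)
    (s x y z w : N) :
    s * (x * (x * (y * (z * w)))) = 0 ∧ s * (y * (x * (x * (z * w)))) = 0 ∧
    s * (y * (z * (x * (x * w)))) = 0 := by
  have hA : ∀ y z w, s * (x * (x * (y * (z * w)))) = - (2 • (s * (y * (x * (x * (z * w)))))) := by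
    intro y z w
    have a1 := nil_pol_first h tf x s y x z w
    have a2 := congrArg (fun t => t * z * w) (nil_three h tf x (s * y))
    have a3 := congrArg (fun t => s * t * z * w) (nil_three h tf x y)
    have a4 := nil_sq_first h tf x s y z w
    simp only [mul_assoc, sub_mul, mul_sub, neg_mul, mul_neg] at a1 a2 a3
    rw [a4] at a2
    rw [a2, a3] at a1
    simp only [neg_zero, zero_sub, neg_sub, sub_neg_eq_add, neg_inj] at a1
    rw [two_nsmul, neg_add, eq_comm]
    nth_rewrite 1 [a1]
    abel
  have hB : ∀ y z w, s * (x * (x * (y * (z * w)))) = - (2 • (s * (y * (z * (x * (x * w)))))) := by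
    intro y z w
    have a1 := nil_pol_first h tf x s y z x w
    have a2 := congrArg (fun t => t * w) (nil_three h tf x (s * (y * z)))
    have a3 := congrArg (fun t => s * t * w) (nil_three h tf x (y * z))
    have a4 := nil_sq_first h tf x s y z w
    simp only [mul_assoc, sub_mul, mul_sub, neg_mul, mul_neg] at a1 a2 a3
    rw [a4] at a2
    rw [a2, a3] at a1
    simp only [neg_zero, zero_sub, neg_sub, sub_neg_eq_add, neg_inj] at a1
    rw [two_nsmul, neg_add, eq_comm]
    nth_rewrite 1 [a1]
    abel
  have hC : ∀ y z w, s * (x * (x * (y * (z * w)))) = - (2 • (s * (y * (z * (w * (x * x)))))) := by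
    intro y z w
    have a1 := nil_pol_first h tf x s y z w x
    have a2 := (nil_three h tf x (s * (y * (z * w))))
    have a3 := congrArg (fun t => s * t) (nil_three h tf x (y * (z * w)))
    have a4 := nil_sq_first h tf x s y z w
    simp only [mul_assoc, sub_mul, mul_sub, neg_mul, mul_neg] at a1 a2 a3
    rw [a4] at a2
    rw [a2, a3] at a1
    simp only [neg_zero, zero_sub, neg_sub, sub_neg_eq_add, neg_inj] at a1
    rw [two_nsmul, neg_add, eq_comm]
    nth_rewrite 1 [a1]
    abel
  have h0 : s * (x * (x * (y * (z * w)))) = 0 := by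
    rw [hC, nil_sq_last h tf]; simp
  refine ⟨h0, ?_, ?_⟩
  · apply tf 2 _ (by norm_num)
    rw [hA] at h0; simpa using h0
  · apply tf 2 _ (by norm_num)
    rw [hB] at h0; simpa using h0

lemma nil_pol_second
    (h : ∀ a b c : N, polCube a b c = 0)
    (tf : ∀ (n : ℕ) (x : N), n ≠ 0 → n • x = 0 → x = 0)
    (x s y z w v : N) :
    y * (x * (s * (z * (w * v)))) = - (y * (s * (x * (z * (w * v))))) := by
  have h1 := (nil_aux h tf y (x + s) z w v).1
  have h2 := (nil_aux h tf y x z w v).1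
  have h3 := (nil_aux h tf y s z w v).1
  simp only [add_mul, mul_add, h2, h3, zero_add, add_zero] at h1
  exact eq_neg_of_add_eq_zero_right h1

lemma nil_pol_third
    (h : ∀ a b c : N, polCube a b c = 0)
    (tf : ∀ (n : ℕ) (x : N), n ≠ 0 → n • x = 0 → x = 0)
    (x s y z w v : N) :
    y * (z * (x * (s * (w * v)))) = - (y * (z * (s * (x * (w * v))))) := by
  have h1 := (nil_aux h tf y (x + s) z w v).2.1
  have h2 := (nil_aux h tf y x z w v).2.1
  have h3 := (nil_aux h tf y s z w v).2.1
  simp only [add_mul, mul_add, h2, h3, zero_add, add_zero] at h1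
  exact eq_neg_of_add_eq_zero_right h1

lemma nil_pol_fourth
    (h : ∀ a b c : N, polCube a b c = 0)
    (tf : ∀ (n : ℕ) (x : N), n ≠ 0 → n • x = 0 → x = 0)
    (x s y z w v : N) :
    y * (z * (w * (x * (s * v)))) = - (y * (z * (w * (s * (x * v))))) := by
  have h1 := (nil_aux h tf y (x + s) z w v).2.2
  have h2 := (nil_aux h tf y x z w v).2.2
  have h3 := (nil_aux h tf y s z w v).2.2
  simp only [add_mul, mul_add, h2, h3, zero_add, add_zero] at h1
  exact eq_neg_of_add_eq_zero_right h1

lemma nil_pol_fifth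
    (h : ∀ a b c : N, polCube a b c = 0)
    (tf : ∀ (n : ℕ) (x : N), n ≠ 0 → n • x = 0 → x = 0)
    (x s y z w v : N) :
    y * (z * (w * (v * (x * s)))) = - (y * (z * (w * (v * (s * x))))) := by
  have h1 := (nil_sq_last h tf (x + s) y z w v)
  have h2 := (nil_sq_last h tf x y z w v)
  have h3 := (nil_sq_last h tf s y z w v)
  simp only [add_mul, mul_add, h2, h3, zero_add, add_zero] at h1
  exact eq_neg_of_add_eq_zero_right h1

/-- The Nagata-Higman theorem for exponent three, with the optimal bound six. -/
lemma nil_six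
    (h : ∀ a b c : N, polCube a b c = 0)
    (tf : ∀ (n : ℕ) (x : N), n ≠ 0 → n • x = 0 → x = 0)
    (a b c d e f : N) : a * (b * (c * (d * (e * f)))) = 0 := by
  have T1 : ∀ a b c d e f : N, c * (d * (a * (b * (e * f)))) = a * (b * (c * (d * (e * f)))) := by
    intro a b c d e f
    rw [nil_pol_second h tf d a, nil_pol_first h tf c a, nil_pol_third h tf d b,
      nil_pol_second h tf c b]
    simp
  have T2 : ∀ a b c d e f : N, a * (b * (e * (f * (c * d)))) = a * (b * (c * (d * (e * f)))) := by
    intro a b c d e f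
    rw [nil_pol_fourth h tf f c, nil_pol_third h tf e c, nil_pol_fifth h tf f d,
      nil_pol_fourth h tf e d]
    simp
  have := h (a * b) (c * d) (e * f)
  simp only [polCube, mul_assoc] at this
  rw [T2 a b c d e f, T1 a b c d e f, T2 c d a b e f, T1 a b e f c d, T1 c d e f a b,
    T2 c d a b e f, T1 a b c d e f, T2 a b c d e f] at this
  apply tf 6 _ (by norm_num)
  rw [← this]
  abel
end NilRing

section FreeWords
variable {S Q : Type} [AddCommGroup Q] [Module ℂ Q]

noncomputable def wordLin (g : FreeSemigroup S → Q) :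
    MonoidAlgebra ℂ (FreeSemigroup S) → Q :=
  fun p => Finsupp.linearCombination ℂ g p.coeff

lemma wordLin_add (g : FreeSemigroup S → Q) (p q : MonoidAlgebra ℂ (FreeSemigroup S)) :
    wordLin g (p + q) = wordLin g p + wordLin g q := by
  simp [wordLin]

lemma wordLin_zero (g : FreeSemigroup S → Q) : wordLin g 0 = 0 := by
  simp [wordLin]

lemma wordLin_neg (g : FreeSemigroup S → Q) (p : MonoidAlgebra ℂ (FreeSemigroup S)) :
    wordLin g (-p) = - wordLin g p := by
  simp [wordLin]

lemma wordLin_nsmul (g : FreeSemigroup S → Q) (n : ℕ) (p : MonoidAlgebra ℂ (FreeSemigroup S)) :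
    wordLin g (n • p) = n • wordLin g p := by
  induction n with
  | zero => simp [wordLin_zero]
  | succ n ih => rw [succ_nsmul, succ_nsmul, wordLin_add, ih]

lemma wordLin_single (g : FreeSemigroup S → Q) (w : FreeSemigroup S) (c : ℂ) :
    wordLin g (MonoidAlgebra.single w c) = c • g w := by
  simp [wordLin]

/-- the ideal of elements killed by `g` in every context -/
noncomputable def wordIdeal (g : FreeSemigroup S → Q) :
    TwoSidedIdeal (MonoidAlgebra ℂ (FreeSemigroup S)) :=
  TwoSidedIdeal.mk' {p | wordLin g p = 0 ∧ (∀ u, wordLin g (u * p) = 0) ∧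
      (∀ v, wordLin g (p * v) = 0) ∧ ∀ u v, wordLin g (u * p * v) = 0}
    (by simp [wordLin_zero])
    (by
      rintro x y ⟨h1, h2, h3, h4⟩ ⟨k1, k2, k3, k4⟩
      refine ⟨?_, ?_, ?_, ?_⟩ <;> intros <;> simp only [mul_add, add_mul, wordLin_add, *, add_zero])
    (by
      rintro x ⟨h1, h2, h3, h4⟩
      refine ⟨?_, ?_, ?_, ?_⟩ <;> intros <;>
        simp only [mul_neg, neg_mul, wordLin_neg, *, neg_zero])
    (by
      rintro x y ⟨h1, h2, h3, h4⟩
      refine ⟨h2 _, fun u => ?_, fun v => h4 _ _, fun u v => ?_⟩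
      · rw [← mul_assoc]; exact h2 _
      · rw [← mul_assoc]; exact h4 _ _)
    (by
      rintro x y ⟨h1, h2, h3, h4⟩
      refine ⟨h3 _, fun u => ?_, fun v => ?_, fun u v => ?_⟩
      · rw [← mul_assoc]; exact h4 _ _
      · rw [mul_assoc]; exact h3 _
      · rw [← mul_assoc u, mul_assoc]; exact h4 _ _)

lemma mem_wordIdeal (g : FreeSemigroup S → Q) (p : MonoidAlgebra ℂ (FreeSemigroup S)) :
    p ∈ wordIdeal g ↔ wordLin g p = 0 ∧ (∀ u, wordLin g (u * p) = 0) ∧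
      (∀ v, wordLin g (p * v) = 0) ∧ ∀ u v, wordLin g (u * p * v) = 0 := by
  unfold wordIdeal
  rw [TwoSidedIdeal.mem_mk']
  rfl

lemma wordLin_polCube (g : FreeSemigroup S → Q) 
    (h : ∀ a b c, g (a * b * c) + g (a * c * b) + g (b * a * c) + g (b * c * a) + g (c * a * b)
      + g (c * b * a) = 0) (a b c : MonoidAlgebra ℂ (FreeSemigroup S)) :
    wordLin g (polCube a b c) = 0 := by
  induction a using MonoidAlgebra.induction_linear with
  | zero => simp [polCube, wordLin_zero]
  | add x y hx hy =>
    have : polCube (x + y) b c = polCube x b c + polCube y b c := by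
      simp only [polCube]; noncomm_ring
    rw [this, wordLin_add, hx, hy, add_zero]
  | single a ra =>
  induction b using MonoidAlgebra.induction_linear with
  | zero => simp [polCube, wordLin_zero]
  | add x y hx hy =>
    have : ∀ a, polCube a (x + y) c = polCube a x c + polCube a y c := by
      intro a; simp only [polCube]; noncomm_ring
    rw [this, wordLin_add, hx, hy, add_zero]
  | single b rb =>
  induction c using MonoidAlgebra.induction_linear with
  | zero => simp [polCube, wordLin_zero]
  | add x y hx hy =>
    have : ∀ a b, polCube a b (x + y) = polCube a b x + polCube a b y := by
      intro a b; simp only [polCube]; noncomm_ring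
    rw [this, wordLin_add, hx, hy, add_zero]
  | single c rc =>
    simp only [polCube, MonoidAlgebra.single_mul_single, wordLin_add, wordLin_single]
    have := congrArg (fun t => (ra * rb * rc) • t) (h a b c)
    simp only [smul_add, smul_zero] at this
    have e1 : ra * rc * rb = ra * rb * rc := by ring
    have e2 : rb * ra * rc = ra * rb * rc := by ring
    have e3 : rb * rc * ra = ra * rb * rc := by ring
    have e4 : rc * ra * rb = ra * rb * rc := by ring
    have e5 : rc * rb * ra = ra * rb * rc := by ring
    rw [e1, e2, e3, e4, e5]
    exact this

lemma wordLin_mul_left (g : FreeSemigroup S → Q) (p : MonoidAlgebra ℂ (FreeSemigroup S))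
    (h : ∀ u, wordLin (fun w => g (u * w)) p = 0) (u : MonoidAlgebra ℂ (FreeSemigroup S)) :
    wordLin g (u * p) = 0 := by
  induction u using MonoidAlgebra.induction_linear with
  | zero => simp [wordLin_zero]
  | add x y hx hy => rw [add_mul, wordLin_add, hx, hy, add_zero]
  | single u r =>
    have key : wordLin g (MonoidAlgebra.single u r * p) = r • wordLin (fun w => g (u * w)) p := by
      clear h
      induction p using MonoidAlgebra.induction_linear with
      | zero => simp [wordLin_zero]
      | add x y hx hy => rw [mul_add, wordLin_add, hx, hy, wordLin_add, smul_add]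
      | single w c =>
        rw [MonoidAlgebra.single_mul_single, wordLin_single, wordLin_single, mul_smul]
    rw [key, h, smul_zero]

lemma wordLin_mul_right (g : FreeSemigroup S → Q) (p : MonoidAlgebra ℂ (FreeSemigroup S))
    (h : ∀ v, wordLin (fun w => g (w * v)) p = 0) (v : MonoidAlgebra ℂ (FreeSemigroup S)) :
    wordLin g (p * v) = 0 := by
  induction v using MonoidAlgebra.induction_linear with
  | zero => simp [wordLin_zero]
  | add x y hx hy => rw [mul_add, wordLin_add, hx, hy, add_zero]
  | single v r =>
    have key : wordLin g (p * MonoidAlgebra.single v r) = r • wordLin (fun w => g (w * v)) p := by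
      clear h
      induction p using MonoidAlgebra.induction_linear with
      | zero => simp [wordLin_zero]
      | add x y hx hy => rw [add_mul, wordLin_add, hx, hy, wordLin_add, smul_add]
      | single w c =>
        rw [MonoidAlgebra.single_mul_single, wordLin_single, wordLin_single, mul_comm, mul_smul]
    rw [key, h, smul_zero]

/-- six terms of the polarised cube, for a function on words -/
def sixSum (g : FreeSemigroup S → Q) (a b c : FreeSemigroup S) : Q :=
  g (a * b * c) + g (a * c * b) + g (b * a * c) + g (b * c * a) + g (c * a * b) + g (c * b * a)

lemma word_six (g : FreeSemigroup S → Q)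
    (h1 : ∀ a b c, sixSum g a b c = 0)
    (h2 : ∀ u a b c, sixSum (fun w => g (u * w)) a b c = 0)
    (h3 : ∀ v a b c, sixSum (fun w => g (w * v)) a b c = 0)
    (h4 : ∀ u v a b c, sixSum (fun w => g (u * w * v)) a b c = 0)
    (a b c d e f : FreeSemigroup S) : g (a * (b * (c * (d * (e * f))))) = 0 := by
  have hK : ∀ a b c, polCube a b c ∈ wordIdeal g := by
    intro a b c
    rw [mem_wordIdeal]
    refine ⟨wordLin_polCube g h1 _ _ _, ?_, ?_, ?_⟩
    · exact wordLin_mul_left g _ fun u => wordLin_polCube _ (h2 u) _ _ _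
    · exact wordLin_mul_right g _ fun u => wordLin_polCube _ (h3 u) _ _ _
    · intro u v
      apply wordLin_mul_right
      intro v
      apply wordLin_mul_left
      intro u
      exact wordLin_polCube _ (h4 u v) _ _ _
  let N := (wordIdeal g).ringCon.Quotient
  have hN : ∀ a b c : N, polCube a b c = 0 := by
    intro a b c
    obtain ⟨a, rfl⟩ := Quotient.exists_rep a
    obtain ⟨b, rfl⟩ := Quotient.exists_rep b
    obtain ⟨c, rfl⟩ := Quotient.exists_rep c
    have := hK a b c
    exact (RingCon.eq (wordIdeal g).ringCon).2 ((TwoSidedIdeal.mem_iff _ _).1 this)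
  have tf : ∀ (n : ℕ) (x : N), n ≠ 0 → n • x = 0 → x = 0 := by
    intro n x hn hx
    obtain ⟨x, rfl⟩ := Quotient.exists_rep x
    have hx' : n • x ∈ wordIdeal g :=
      (TwoSidedIdeal.mem_iff _ _).2 ((RingCon.eq (wordIdeal g).ringCon).1 hx)
    refine (RingCon.eq (wordIdeal g).ringCon).2 ((TwoSidedIdeal.mem_iff _ _).1 ?_)
    rw [mem_wordIdeal] at hx' ⊢
    have hq : ∀ q : Q, n • q = 0 → q = 0 := by
      intro q hq
      rw [← Nat.cast_smul_eq_nsmul ℂ] at hq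
      exact (smul_eq_zero.1 hq).resolve_left (by exact_mod_cast hn)
    obtain ⟨e1, e2, e3, e4⟩ := hx'
    refine ⟨hq _ ?_, fun u => hq _ ?_, fun v => hq _ ?_, fun u v => hq _ ?_⟩
    · rw [← wordLin_nsmul, e1]
    · rw [← wordLin_nsmul, ← mul_smul_comm, e2]
    · rw [← wordLin_nsmul, ← smul_mul_assoc, e3]
    · rw [← wordLin_nsmul, ← smul_mul_assoc, ← mul_smul_comm, e4]
  let i : FreeSemigroup S → MonoidAlgebra ℂ (FreeSemigroup S) := fun w => MonoidAlgebra.single w 1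
  let j : FreeSemigroup S → N := fun w => (i w : (wordIdeal g).ringCon.Quotient)
  have := nil_six hN tf (j a) (j b) (j c) (j d) (j e) (j f)
  have hm : i a * (i b * (i c * (i d * (i e * i f)))) ∈ wordIdeal g :=
    (TwoSidedIdeal.mem_iff _ _).2 ((RingCon.eq (wordIdeal g).ringCon).1 this)
  rw [mem_wordIdeal] at hm
  have := hm.1
  simp only [i, MonoidAlgebra.single_mul_single, wordLin_single, mul_one, one_smul] at this
  exact this
end FreeWords

section WordTraces

lemma cubic_identity (a b c z : Matrix (Fin 3) (Fin 3) ℂ) :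
    (a * b * c * z).trace + (a * c * b * z).trace + (b * a * c * z).trace
      + (b * c * a * z).trace + (c * a * b * z).trace + (c * b * a * z).trace
    = a.trace * ((b * c * z).trace + (c * b * z).trace)
      + b.trace * ((a * c * z).trace + (c * a * z).trace)
      + c.trace * ((a * b * z).trace + (b * a * z).trace)
      - (a.trace * b.trace - (a * b).trace) * (c * z).trace
      - (a.trace * c.trace - (a * c).trace) * (b * z).trace
      - (b.trace * c.trace - (b * c).trace) * (a * z).trace
      + (a.trace * b.trace * c.trace - a.trace * (b * c).trace - b.trace * (a * c).trace
        - c.trace * (a * b).trace + (a * b * c).trace + (a * c * b).trace) * z.trace := by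
  have key : a * b * c + a * c * b + b * a * c + b * c * a + c * a * b + c * b * a
    = a.trace • (b * c + c * b)
      + b.trace • (a * c + c * a)
      + c.trace • (a * b + b * a)
      - (a.trace * b.trace - (a * b).trace) • c
      - (a.trace * c.trace - (a * c).trace) • b
      - (b.trace * c.trace - (b * c).trace) • a
      + (a.trace * b.trace * c.trace - a.trace * (b * c).trace - b.trace * (a * c).trace
        - c.trace * (a * b).trace + (a * b * c).trace + (a * c * b).trace) • 1 := by
    ext i j
    fin_cases i <;> fin_cases j <;>
    simp [Matrix.trace, Matrix.mul_apply, Fin.sum_univ_three] <;> ring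
  have := congrArg (fun t => (t * z).trace) key
  simpa only [add_mul, sub_mul, Matrix.trace_add, Matrix.trace_sub, Matrix.smul_mul,
    Matrix.trace_smul, smul_eq_mul, one_mul] using this

variable {S T : Type} (M : S → T → Matrix (Fin 3) (Fin 3) ℂ) (A : Subalgebra ℂ (T → ℂ))

/-- evaluation of words -/
def evW (w : FreeSemigroup S) (X : T) : Matrix (Fin 3) (Fin 3) ℂ :=
  FreeSemigroup.lift (fun s => M s X) w

lemma evW_mul (v w : FreeSemigroup S) (X : T) : evW M (v * w) X = evW M v X * evW M w X := by
  simp [evW]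

/-- trace of words -/
def trW (w : FreeSemigroup S) : T → ℂ := fun X => (evW M w X).trace

lemma trW_cyc (v w : FreeSemigroup S) : trW M (v * w) = trW M (w * v) := by
  funext X
  simp only [trW, evW_mul]
  exact Matrix.trace_mul_comm _ _

lemma length_pos' (w : FreeSemigroup S) : 1 ≤ w.length := by
  simp [FreeSemigroup.length]

lemma six_mem (n : ℕ) (IH : ∀ w : FreeSemigroup S, w.length < n → trW M w ∈ A)
    (a b c z : FreeSemigroup S) (hn : (a * b * c * z).length ≤ n) :
    sixSum (fun w => trW M (w * z)) a b c ∈ A := by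
  have e : sixSum (fun w => trW M (w * z)) a b c =
      trW M a * (trW M (b * c * z) + trW M (c * b * z))
      + trW M b * (trW M (a * c * z) + trW M (c * a * z))
      + trW M c * (trW M (a * b * z) + trW M (b * a * z))
      - (trW M a * trW M b - trW M (a * b)) * trW M (c * z)
      - (trW M a * trW M c - trW M (a * c)) * trW M (b * z)
      - (trW M b * trW M c - trW M (b * c)) * trW M (a * z)
      + (trW M a * trW M b * trW M c - trW M a * trW M (b * c) - trW M b * trW M (a * c)
        - trW M c * trW M (a * b) + trW M (a * b * c) + trW M (a * c * b)) * trW M z := by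
    funext X
    simp only [sixSum, Pi.add_apply, Pi.sub_apply, Pi.mul_apply, trW, evW_mul]
    exact cubic_identity _ _ _ _
  have ha := length_pos' a
  have hb := length_pos' b
  have hc := length_pos' c
  have hz := length_pos' z
  simp only [FreeSemigroup.length_mul] at hn
  rw [e]
  repeat' first
    | (with_reducible apply IH; simp only [FreeSemigroup.length_mul]; omega)
    | (with_reducible apply IH; omega)
    | apply A.add_mem
    | apply A.sub_mem
    | apply A.mul_mem

lemma exists_split (w : FreeSemigroup S) (h : 2 ≤ w.length) :
    ∃ (s : S) (v : FreeSemigroup S), w = FreeSemigroup.of s * v := by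
  rcases w with ⟨s, t⟩
  rcases t with _ | ⟨t, l⟩
  · simp [FreeSemigroup.length] at h
  · exact ⟨s, ⟨t, l⟩, rfl⟩

lemma trW_mem (hA : ∀ w : FreeSemigroup S, w.length ≤ 6 → trW M w ∈ A) (w : FreeSemigroup S) :
    trW M w ∈ A := by
  generalize hn : w.length = n
  induction n using Nat.strong_induction_on generalizing w with
  | _ n ih =>
  by_cases h6 : n ≤ 6
  · exact hA w (by omega)
  have IH : ∀ w : FreeSemigroup S, w.length < n → trW M w ∈ A := fun w hw => ih _ hw w rfl
  obtain ⟨x1, w1, rfl⟩ := exists_split w (by omega)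
  simp only [FreeSemigroup.length_mul, FreeSemigroup.length_of] at hn
  obtain ⟨x2, w2, rfl⟩ := exists_split w1 (by omega)
  simp only [FreeSemigroup.length_mul, FreeSemigroup.length_of] at hn
  obtain ⟨x3, w3, rfl⟩ := exists_split w2 (by omega)
  simp only [FreeSemigroup.length_mul, FreeSemigroup.length_of] at hn
  obtain ⟨x4, w4, rfl⟩ := exists_split w3 (by omega)
  simp only [FreeSemigroup.length_mul, FreeSemigroup.length_of] at hn
  obtain ⟨x5, w5, rfl⟩ := exists_split w4 (by omega)
  simp only [FreeSemigroup.length_mul, FreeSemigroup.length_of] at hn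
  obtain ⟨x6, z, rfl⟩ := exists_split w5 (by omega)
  simp only [FreeSemigroup.length_mul, FreeSemigroup.length_of] at hn
  let K : Submodule ℂ (T → ℂ) := Subalgebra.toSubmodule A
  let g : FreeSemigroup S → (T → ℂ) ⧸ K := fun w =>
    if w.length = 6 then K.mkQ (trW M (w * z)) else 0
  have six : ∀ z' a b c : FreeSemigroup S, (a * b * c * z').length ≤ n →
      sixSum (fun w => K.mkQ (trW M (w * z'))) a b c = 0 := by
    intro z' a b c hl
    have := six_mem M A n IH a b c z' hl
    have h2 : K.mkQ (sixSum (fun w => trW M (w * z')) a b c) = 0 := by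
      rw [Submodule.mkQ_apply, Submodule.Quotient.mk_eq_zero]
      exact this
    rw [← h2]
    simp only [sixSum, map_add]
  have gen : ∀ (F : FreeSemigroup S → FreeSemigroup S) (k : ℕ) (z' : FreeSemigroup S)
      (hF : ∀ w, (F w).length = w.length + k) (hz : z'.length = z.length + k)
      (hFz : ∀ w, trW M (F w * z) = trW M (w * z')) (a b c : FreeSemigroup S),
      sixSum (fun w => g (F w)) a b c = 0 := by
    intro F k z' hF hz hFz a b c
    by_cases hl : a.length + b.length + c.length + k = 6
    · have hs := six z' a b c (by simp only [FreeSemigroup.length_mul]; omega)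
      rw [← hs]
      simp only [sixSum, g]
      simp only [hF, hFz, FreeSemigroup.length_mul]
      rw [if_pos (by omega), if_pos (by omega), if_pos (by omega), if_pos (by omega),
        if_pos (by omega), if_pos (by omega)]
    · simp only [sixSum, g]
      simp only [hF, hFz, FreeSemigroup.length_mul]
      rw [if_neg (by omega), if_neg (by omega), if_neg (by omega), if_neg (by omega),
        if_neg (by omega), if_neg (by omega)]
      simp
  have fin := word_six g
    (gen (fun w => w) 0 z (by simp) (by simp) (by simp))
    (fun u => gen (fun w => u * w) u.length (z * u)
      (by intro w; simp only [FreeSemigroup.length_mul]; omega)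
      (by simp only [FreeSemigroup.length_mul])
      (by intro w; rw [mul_assoc, trW_cyc, mul_assoc]))
    (fun v => gen (fun w => w * v) v.length (v * z)
      (by intro w; simp only [FreeSemigroup.length_mul])
      (by simp only [FreeSemigroup.length_mul]; omega)
      (by intro w; rw [mul_assoc]))
    (fun u v => gen (fun w => u * w * v) (u.length + v.length) (v * z * u)
      (by intro w; simp only [FreeSemigroup.length_mul]; omega)
      (by simp only [FreeSemigroup.length_mul]; omega)
      (by intro w; rw [mul_assoc, mul_assoc, trW_cyc, mul_assoc, ← mul_assoc w]))
    (.of x1) (.of x2) (.of x3) (.of x4) (.of x5) (.of x6)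
  simp only [g, FreeSemigroup.length_mul, FreeSemigroup.length_of] at fin
  norm_num at fin
  have : trW M _ ∈ A := fin
  simpa only [mul_assoc] using this

end WordTraces

section PermTraces
variable {S T : Type} (M : S → T → Matrix (Fin 3) (Fin 3) ℂ) (A : Subalgebra ℂ (T → ℂ))

/-- the generalised trace attached to a permutation -/
def permTr {n : ℕ} (w : Fin n → FreeSemigroup S) (σ : Equiv.Perm (Fin n)) : T → ℂ :=
  fun X => ∑ a : Fin n → Fin 3, ∏ j, evW M (w j) X (a j) (a (σ j))

lemma permTr_mem (hA : ∀ w : FreeSemigroup S, trW M w ∈ A) :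
    ∀ (n : ℕ) (w : Fin n → FreeSemigroup S) (σ : Equiv.Perm (Fin n)), permTr M w σ ∈ A := by
  intro n
  induction n with
  | zero =>
    intro w σ
    have : permTr M w σ = 1 := by
      funext X
      simp [permTr]
    rw [this]
    exact A.one_mem
  | succ n ih =>
    intro w σ
    obtain ⟨⟨p, τ⟩, rfl⟩ := Equiv.Perm.decomposeFin.symm.surjective σ
    refine Fin.cases ?_ (fun i => ?_) p
    · have : permTr M w (Equiv.Perm.decomposeFin.symm (0, τ)) =
          trW M (w 0) * permTr M (fun j => w j.succ) τ := by
        funext X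
        simp only [permTr, trW, Pi.mul_apply]
        rw [← (Fin.consEquiv (fun _ => Fin 3)).sum_comp, Fintype.sum_prod_type]
        simp only [Fin.prod_univ_succ, Fin.consEquiv_apply, Fin.cons_zero, Fin.cons_succ,
          Equiv.Perm.decomposeFin_symm_apply_zero, Equiv.Perm.decomposeFin_symm_apply_succ,
          Equiv.swap_self, Equiv.refl_apply]
        rw [Matrix.trace, Finset.sum_mul_sum]
        rfl
      rw [this]
      exact A.mul_mem (hA _) (ih _ _)
    · have : permTr M w (Equiv.Perm.decomposeFin.symm (i.succ, τ)) =
          permTr M (Function.update (fun j => w j.succ) (τ.symm i) (w (τ.symm i).succ * w 0)) τ := by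
        funext X
        simp only [permTr]
        rw [← (Fin.consEquiv (fun _ => Fin 3)).sum_comp, Fintype.sum_prod_type, Finset.sum_comm]
        refine Finset.sum_congr rfl fun a _ => ?_
        simp only [Fin.prod_univ_succ, Fin.consEquiv_apply, Fin.cons_zero, Fin.cons_succ,
          Equiv.Perm.decomposeFin_symm_apply_zero, Equiv.Perm.decomposeFin_symm_apply_succ]
        rw [← Finset.mul_prod_erase Finset.univ _ (Finset.mem_univ (τ.symm i))]
        simp only [Function.update_self, evW_mul, Matrix.mul_apply, Equiv.apply_symm_apply]
        rw [Finset.sum_mul]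
        refine Finset.sum_congr rfl fun x _ => ?_
        rw [← Finset.mul_prod_erase Finset.univ _ (Finset.mem_univ (τ.symm i)), ← mul_assoc]
        simp only [Equiv.apply_symm_apply, Equiv.swap_apply_right, Fin.cons_zero]
        congr 1
        · ring
        · refine Finset.prod_congr rfl fun j hj => ?_
          have hj' := Finset.ne_of_mem_erase hj
          have : τ j ≠ i := fun h => hj' (by rw [← h]; simp)
          rw [Function.update_of_ne hj', Equiv.swap_apply_of_ne_of_ne (Fin.succ_ne_zero _)
            (fun h => this (Fin.succ_injective _ h)), Fin.cons_succ]
      rw [this]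
      exact ih _ _

end PermTraces

section Tens
variable {d : ℕ}

/-- Kronecker (tensor) product of a family of matrices -/
def tens (Y : Fin d → Matrix (Fin 3) (Fin 3) ℂ) : Matrix (Fin d → Fin 3) (Fin d → Fin 3) ℂ :=
  Matrix.of fun b a => ∏ j, Y j (b j) (a j)

lemma tens_apply (Y : Fin d → Matrix (Fin 3) (Fin 3) ℂ) (b a : Fin d → Fin 3) :
    tens Y b a = ∏ j, Y j (b j) (a j) := rfl

lemma tens_mul (Y Z : Fin d → Matrix (Fin 3) (Fin 3) ℂ) :
    tens (fun j => Y j * Z j) = tens Y * tens Z := by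
  ext b a
  simp only [tens_apply, Matrix.mul_apply, Finset.prod_univ_sum, Fintype.piFinset_univ,
    Finset.prod_mul_distrib]

lemma tens_one : tens (fun _ : Fin d => 1) = 1 := by
  ext b a
  rw [tens_apply, Matrix.one_apply]
  split_ifs with h
  · subst h; simp
  · obtain ⟨j, hj⟩ := Function.ne_iff.1 h
    exact Finset.prod_eq_zero (Finset.mem_univ j) (Matrix.one_apply_ne hj)

lemma tens_smul (c : ℂ) (A : Matrix (Fin 3) (Fin 3) ℂ) :
    tens (fun _ : Fin d => c • A) = c ^ d • tens (fun _ => A) := by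
  ext b a
  simp [tens_apply, Finset.prod_mul_distrib]

lemma tens_conjTranspose (Y : Fin d → Matrix (Fin 3) (Fin 3) ℂ) :
    tens (fun j => (Y j).conjTranspose) = (tens Y).conjTranspose := by
  ext b a
  simp [tens_apply, Matrix.conjTranspose_apply]

lemma tens_single (b a : Fin d → Fin 3) :
    tens (fun j => Matrix.single (b j) (a j) (1 : ℂ)) = Matrix.single b a 1 := by
  ext x y
  rw [tens_apply, Matrix.single_apply]
  split_ifs with h
  · obtain ⟨rfl, rfl⟩ := h; simp
  · have : (∃ j, b j ≠ x j) ∨ ∃ j, a j ≠ y j := by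
      by_contra hc
      push Not at hc
      exact h ⟨funext hc.1, funext hc.2⟩
    rcases this with ⟨j, hj⟩ | ⟨j, hj⟩
    · exact Finset.prod_eq_zero (Finset.mem_univ j) (by simp [hj])
    · exact Finset.prod_eq_zero (Finset.mem_univ j) (by simp [hj])

/-- permutation of tensor factors -/
def permM : Equiv.Perm (Fin d) →* Matrix (Fin d → Fin 3) (Fin d → Fin 3) ℂ where
  toFun σ := Matrix.of fun b a => if b ∘ σ = a then 1 else 0
  map_one' := by
    ext b a
    simp [Matrix.one_apply]
  map_mul' σ τ := by
    ext b a
    rw [Matrix.mul_apply, Finset.sum_eq_single (b ∘ σ)]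
    · simp only [Matrix.of_apply, Equiv.Perm.coe_mul, Function.comp_assoc, if_true, one_mul]
      congr
    · intro c _ hc
      simp [Ne.symm hc]
    · simp

lemma permM_mul (σ : Equiv.Perm (Fin d)) (T : Matrix (Fin d → Fin 3) (Fin d → Fin 3) ℂ)
    (b a : Fin d → Fin 3) : (permM σ * T) b a = T (b ∘ σ) a := by
  simp [permM, Matrix.mul_apply]

lemma mul_permM (σ : Equiv.Perm (Fin d)) (T : Matrix (Fin d → Fin 3) (Fin d → Fin 3) ℂ)
    (b a : Fin d → Fin 3) : (T * permM σ) b a = T b (a ∘ σ.symm) := by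
  have : ∀ c : Fin d → Fin 3, c ∘ σ = a ↔ c = a ∘ σ.symm := by
    intro c
    constructor
    · rintro rfl; ext; simp
    · rintro rfl; ext; simp
  simp [permM, Matrix.mul_apply, this]

lemma permM_conj_tens (σ : Equiv.Perm (Fin d)) (Y : Fin d → Matrix (Fin 3) (Fin 3) ℂ) :
    permM σ * tens Y * permM σ⁻¹ = tens (Y ∘ σ.symm) := by
  ext b a
  rw [mul_permM, permM_mul, tens_apply, tens_apply,
    ← Equiv.prod_comp σ (fun i => (Y ∘ σ.symm) i (b i) (a i))]
  simp [Equiv.Perm.inv_def]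

lemma trace_permM_tens (σ : Equiv.Perm (Fin d)) (Y : Fin d → Matrix (Fin 3) (Fin 3) ℂ) :
    (permM σ * tens Y).trace = ∑ a : Fin d → Fin 3, ∏ j, Y j (a j) (a (σ⁻¹ j)) := by
  rw [Matrix.trace, ← (Equiv.arrowCongr σ (Equiv.refl (Fin 3))).sum_comp]
  refine Finset.sum_congr rfl fun a _ => ?_
  rw [Matrix.diag_apply, permM_mul, tens_apply]
  refine Finset.prod_congr rfl fun j _ => ?_
  simp [Equiv.arrowCongr, Equiv.Perm.inv_def]

/-- polarisation -/
lemma polarise (φ : Matrix (Fin d → Fin 3) (Fin d → Fin 3) ℂ →ₗ[ℂ] ℂ)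
    (h : ∀ A, φ (tens fun _ => A) = 0) (Y : Fin d → Matrix (Fin 3) (Fin 3) ℂ) :
    ∑ σ : Equiv.Perm (Fin d), φ (tens (Y ∘ σ)) = 0 := by
  classical
  let p : MvPolynomial (Fin d) ℂ := ∑ f : Fin d → Fin d,
    MvPolynomial.monomial (∑ j, Finsupp.single (f j) 1) (φ (tens (Y ∘ f)))
  have hexp : ∀ t : Fin d → ℂ, tens (fun _ => ∑ j, t j • Y j) =
      ∑ f : Fin d → Fin d, (∏ j, t (f j)) • tens (Y ∘ f) := by
    intro t
    ext b a
    simp only [tens_apply, Matrix.sum_apply, Matrix.smul_apply, smul_eq_mul,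
      Finset.prod_univ_sum, Fintype.piFinset_univ, Finset.prod_mul_distrib, Function.comp]
  have hp : p = 0 := by
    apply MvPolynomial.funext
    intro t
    rw [map_zero, ← h (∑ j, t j • Y j), hexp t, map_sum, map_sum]
    refine Finset.sum_congr rfl fun f _ => ?_
    rw [map_smul, MvPolynomial.eval_monomial, smul_eq_mul, mul_comm]
    congr 1
    rw [← Finsupp.prod_finsetSum_index (by simp) (by intros; rw [pow_add])]
    simp
  have hc := congrArg (MvPolynomial.coeff (∑ j, Finsupp.single j 1)) hp
  simp only [p, MvPolynomial.coeff_sum, MvPolynomial.coeff_monomial, MvPolynomial.coeff_zero] at hc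
  rw [← Finset.sum_filter] at hc
  rw [← hc]
  refine Finset.sum_bij (fun σ _ => (σ : Fin d → Fin d)) ?_ ?_ ?_ ?_
  · intro σ _
    simp only [Finset.mem_filter, Finset.mem_univ, true_and]
    exact Equiv.sum_comp σ (fun j => Finsupp.single j 1)
  · intro σ _ τ _ hst
    exact DFunLike.coe_injective hst
  · intro f hf
    simp only [Finset.mem_filter, Finset.mem_univ, true_and] at hf
    have hs : Function.Surjective f := by
      intro i
      by_contra hi
      push Not at hi
      have := DFunLike.congr_fun hf i
      simp [Finsupp.finsetSum_apply, Finsupp.single_apply, hi] at this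
    exact ⟨Equiv.ofBijective f (Finite.surjective_iff_bijective.1 hs), Finset.mem_univ _, rfl⟩
  · intro σ _; rfl

lemma commute_symmetric (U : Matrix (Fin d → Fin 3) (Fin d → Fin 3) ℂ)
    (hU : ∀ A, U * tens (fun _ => A) = tens (fun _ => A) * U)
    (R : Matrix (Fin d → Fin 3) (Fin d → Fin 3) ℂ) (hR : ∀ σ, permM σ * R = R * permM σ) :
    U * R = R * U := by
  classical
  rw [← sub_eq_zero]
  ext x y
  let φ : Matrix (Fin d → Fin 3) (Fin d → Fin 3) ℂ →ₗ[ℂ] ℂ :=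
    { toFun := fun T => (U * T - T * U) x y
      map_add' := by intro T T'; simp [mul_add, add_mul]; ring
      map_smul' := by intro c T; simp [mul_sub] }
  have hφ : ∀ A, φ (tens fun _ => A) = 0 := by
    intro A
    show (U * tens (fun _ => A) - tens (fun _ => A) * U : Matrix _ _ ℂ) x y = 0
    rw [hU]; simp
  have h1 : ∀ b a, ∑ σ : Equiv.Perm (Fin d), φ (permM σ * Matrix.single b a 1 * permM σ⁻¹) = 0 := by
    intro b a
    rw [← polarise φ hφ (fun j => Matrix.single (b j) (a j) 1), 
      ← Equiv.sum_comp (Equiv.inv (Equiv.Perm (Fin d)))]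
    refine Finset.sum_congr rfl fun σ _ => ?_
    rw [← tens_single, permM_conj_tens]
    rfl
  have h2 : ∑ σ : Equiv.Perm (Fin d), φ (permM σ * R * permM σ⁻¹) = 0 := by
    have hRs : R = ∑ b, ∑ a, R b a • Matrix.single b a (1 : ℂ) := by
      conv_lhs => rw [Matrix.matrix_eq_sum_single R]
      simp [Matrix.smul_single]
    rw [hRs]
    simp only [Finset.mul_sum, Finset.sum_mul, map_sum, Matrix.mul_smul, Matrix.smul_mul, map_smul]
    rw [Finset.sum_comm]
    refine Finset.sum_eq_zero fun b _ => ?_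
    rw [Finset.sum_comm]
    refine Finset.sum_eq_zero fun a _ => ?_
    rw [← Finset.smul_sum, h1, smul_zero]
  have h3 : ∀ σ : Equiv.Perm (Fin d), permM σ * R * permM σ⁻¹ = R := by
    intro σ
    rw [hR, mul_assoc, ← map_mul, mul_inv_cancel, map_one, mul_one]
  simp only [h3, Finset.sum_const, Finset.card_univ, nsmul_eq_mul] at h2
  exact (mul_eq_zero.1 h2).resolve_left (by exact_mod_cast Fintype.card_ne_zero)

end Tens

section DoubleCommutant
variable {H ι : Type} [Group H] [Fintype H] [Fintype ι] [DecidableEq ι]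

lemma double_commutant (P : H →* Matrix ι ι ℂ) (U : Matrix ι ι ℂ)
    (hU : ∀ R : Matrix ι ι ℂ, (∀ h, P h * R = R * P h) → U * R = R * U) :
    U ∈ Submodule.span ℂ (Set.range P) := by
  set C := Submodule.span ℂ (Set.range P) with hC
  obtain ⟨π, hπ⟩ := C.subtype.exists_leftInverse_of_injective (by simp)
  have hπ' : ∀ c : Matrix ι ι ℂ, c ∈ C → (π c : Matrix ι ι ℂ) = c := by
    intro c hc
    have := LinearMap.congr_fun hπ ⟨c, hc⟩
    exact congrArg Subtype.val this
  have hPC : ∀ h, P h ∈ C := fun h => Submodule.subset_span ⟨h, rfl⟩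
  have hCmul : ∀ h c, c ∈ C → P h * c ∈ C := by
    intro h c hc
    induction hc using Submodule.span_induction with
    | mem x hx => obtain ⟨k, rfl⟩ := hx; rw [← map_mul]; exact hPC _
    | zero => simp
    | add x y _ _ hx hy => rw [mul_add]; exact C.add_mem hx hy
    | smul a x _ hx => rw [mul_smul_comm]; exact C.smul_mem _ hx
  let Φ : Matrix ι ι ℂ →ₗ[ℂ] Matrix ι ι ℂ :=
    { toFun := fun X => (Fintype.card H : ℂ)⁻¹ • ∑ h, P h⁻¹ * (π (P h * X) : Matrix ι ι ℂ)
      map_add' := by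
        intro X Y
        simp [mul_add, Finset.sum_add_distrib]
      map_smul' := by
        intro c X
        simp [← Finset.smul_sum, smul_comm c] }
  have hΦ : ∀ X, Φ X = (Fintype.card H : ℂ)⁻¹ • ∑ h, P h⁻¹ * (π (P h * X) : Matrix ι ι ℂ) :=
    fun _ => rfl
  have hΦC : ∀ X, Φ X ∈ C := by
    intro X
    rw [hΦ]
    exact C.smul_mem _ (C.sum_mem fun h _ => hCmul _ _ (π _).2)
  have hΦ1 : Φ 1 = 1 := by
    rw [hΦ]
    have : ∀ h, P h⁻¹ * (π (P h * 1) : Matrix ι ι ℂ) = 1 := by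
      intro h
      rw [mul_one, hπ' _ (hPC h), ← map_mul, inv_mul_cancel, map_one]
    simp only [this, Finset.sum_const, Finset.card_univ]
    rw [← Nat.cast_smul_eq_nsmul ℂ, smul_smul, inv_mul_cancel₀, one_smul]
    exact_mod_cast Fintype.card_ne_zero
  have hΦP : ∀ g X, Φ (P g * X) = P g * Φ X := by
    intro g X
    rw [hΦ, hΦ, mul_smul_comm, Finset.mul_sum]
    congr 1
    rw [← Equiv.sum_comp (Equiv.mulRight g) (fun h => P g * (P h⁻¹ * (π (P h * X) : Matrix ι ι ℂ)))]
    refine Finset.sum_congr rfl fun h _ => ?_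
    simp only [Equiv.coe_mulRight]
    rw [← mul_assoc, ← mul_assoc, ← map_mul, ← map_mul]
    congr 2
    simp
  let L : ι → ι → (ι → ℂ) →ₗ[ℂ] (ι → ℂ) := fun l j =>
    { toFun := fun v => (Φ (Matrix.vecMulVec v (Pi.single l 1))).mulVec (Pi.single j 1)
      map_add' := by
        intro v w
        rw [Matrix.add_vecMulVec, map_add, Matrix.add_mulVec]
      map_smul' := by
        intro c v
        rw [Matrix.smul_vecMulVec, map_smul, Matrix.smul_mulVec, RingHom.id_apply] }
  have hL : ∀ l j v, (L l j).toMatrix'.mulVec v =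
      (Φ (Matrix.vecMulVec v (Pi.single l 1))).mulVec (Pi.single j 1) := by
    intro l j v
    rw [← Matrix.toLin'_apply, Matrix.toLin'_toMatrix']
    rfl
  have ext' : ∀ A B : Matrix ι ι ℂ, (∀ v, A.mulVec v = B.mulVec v) → A = B := by
    intro A B h
    exact Matrix.mulVec_injective (funext h)
  have hcomm : ∀ l j, U * (L l j).toMatrix' = (L l j).toMatrix' * U := by
    intro l j
    apply hU
    intro h
    apply ext'
    intro v
    rw [← Matrix.mulVec_mulVec, ← Matrix.mulVec_mulVec, hL, hL, Matrix.mulVec_mulVec, ← hΦP,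
      Matrix.mul_vecMulVec]
  have hUΦ : ∀ l v, U * Φ (Matrix.vecMulVec v (Pi.single l 1)) =
      Φ (U * Matrix.vecMulVec v (Pi.single l 1)) := by
    intro l v
    ext i j
    have := congrFun (congrArg (fun A => A.mulVec v) (hcomm l j)) i
    simp only [← Matrix.mulVec_mulVec, hL] at this
    rw [Matrix.mulVec_mulVec, ← Matrix.mul_vecMulVec] at this
    simpa [Matrix.mulVec_single] using this
  have h1 : (1 : Matrix ι ι ℂ) = ∑ l, Matrix.vecMulVec (Pi.single l 1) (Pi.single l 1) := by
    ext i j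
    simp [Matrix.sum_apply, Matrix.vecMulVec_apply, Matrix.one_apply, Pi.single_apply]
  have : U = Φ U := by
    calc U = U * Φ 1 := by rw [hΦ1, mul_one]
      _ = Φ (U * 1) := by
        rw [h1, map_sum, Finset.mul_sum, Finset.mul_sum, map_sum]
        exact Finset.sum_congr rfl fun l _ => hUΦ _ _
      _ = Φ U := by rw [mul_one]
  rw [this]
  exact hΦC U

end DoubleCommutant

section Reynolds

lemma comm_all {d : ℕ} (U : Matrix (Fin d → Fin 3) (Fin d → Fin 3) ℂ)
    (hU : ∀ g : SL3, U * tens (fun _ => (g : Matrix (Fin 3) (Fin 3) ℂ))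
      = tens (fun _ => (g : Matrix (Fin 3) (Fin 3) ℂ)) * U)
    (A : Matrix (Fin 3) (Fin 3) ℂ) : U * tens (fun _ => A) = tens (fun _ => A) * U := by
  have hGL : ∀ A : Matrix (Fin 3) (Fin 3) ℂ, A.det ≠ 0 →
      U * tens (fun _ => A) = tens (fun _ => A) * U := by
    intro A hA
    obtain ⟨c, hc⟩ := IsAlgClosed.exists_pow_nat_eq A.det (n := 3) (by norm_num)
    have hc0 : c ≠ 0 := by
      rintro rfl
      apply hA
      rw [← hc]; simp
    let g : SL3 := ⟨c⁻¹ • A, by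
      rw [Matrix.det_smul, Fintype.card_fin, ← hc, inv_pow, inv_mul_cancel₀ (pow_ne_zero _ hc0)]⟩
    have hg : A = c • (g : Matrix (Fin 3) (Fin 3) ℂ) := by
      show A = c • (c⁻¹ • A)
      rw [smul_smul, mul_inv_cancel₀ hc0, one_smul]
    rw [hg, tens_smul, mul_smul_comm, hU g, smul_mul_assoc]
  obtain ⟨A, rfl⟩ : ∃ B, A = -B := ⟨-A, by simp⟩
  ext b a
  let F : ℂ → ℂ := fun s => (U * tens (fun _ => Matrix.scalar (Fin 3) s - A) : Matrix _ _ ℂ) b a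
  let G : ℂ → ℂ := fun s => (tens (fun _ => Matrix.scalar (Fin 3) s - A) * U : Matrix _ _ ℂ) b a
  have hFc : Continuous F := by
    simp only [F, Matrix.mul_apply, tens_apply, Matrix.sub_apply, Matrix.scalar_apply,
      Matrix.diagonal_apply]
    refine continuous_finsetSum _ fun c _ => continuous_const.mul ?_
    refine continuous_finsetProd _ fun j _ => ?_
    split_ifs <;> fun_prop
  have hGc : Continuous G := by
    simp only [G, Matrix.mul_apply, tens_apply, Matrix.sub_apply, Matrix.scalar_apply,
      Matrix.diagonal_apply]
    refine continuous_finsetSum _ fun c _ => Continuous.mul ?_ continuous_const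
    refine continuous_finsetProd _ fun j _ => ?_
    split_ifs <;> fun_prop
  have hd : Dense ({s : ℂ | A.charpoly.IsRoot s}ᶜ) := by
    apply Set.Countable.dense_compl ℂ
    exact (Polynomial.finite_setOfPred_isRoot A.charpoly_monic.ne_zero).countable
  have hFG : F = G := by
    apply Continuous.ext_on hd hFc hGc
    intro s hs
    have : U * tens (fun _ : Fin d => Matrix.scalar (Fin 3) s - A) = _ := hGL _ (by
      rw [← Matrix.eval_charpoly]
      exact hs)
    exact congrFun (congrFun this b) a
  have h0 := congrFun hFG 0
  simpa only [F, G, map_zero, zero_sub] using h0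

lemma unitary_trick {V T G : Type} [NormedAddCommGroup V] [InnerProductSpace ℂ V]
    [FiniteDimensional ℂ V] (ρ : G → V →ₗ[ℂ] V) (st : G → G)
    (hadj : ∀ g x y, inner ℂ x (ρ g y) = inner ℂ (ρ (st g) x) y)
    (E : T → V →ₗ[ℂ] ℂ) (act : G → T → T) (hE : ∀ g X m, E (act g X) m = E X (ρ g m))
    (m : V) (hinv : ∀ g X, E (act g X) m = E X m) :
    ∃ m', (∀ g, ρ g m' = m') ∧ ∀ X, E X m' = E X m := by
  let K : Submodule ℂ V := ⨅ X, LinearMap.ker (E X)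
  have hK : ∀ k, k ∈ K ↔ ∀ X, E X k = 0 := by
    intro k; simp [K, Submodule.mem_iInf]
  obtain ⟨k, hk, m', hm', rfl⟩ := K.exists_add_mem_mem_orthogonal m
  have h1 : ∀ X, E X m' = E X (k + m') := by
    intro X
    rw [map_add, (hK k).1 hk, zero_add]
  refine ⟨m', fun g => ?_, h1⟩
  have h2 : ρ g m' ∈ Kᗮ := by
    rw [Submodule.mem_orthogonal] at hm' ⊢
    intro u hu
    rw [hadj]
    apply hm'
    rw [hK] at hu ⊢
    intro X
    rw [← hE, hu]
  have h3 : ρ g m' - m' ∈ K := by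
    rw [hK]
    intro X
    rw [map_sub, ← hE, h1, h1, hinv, sub_self]
  have h4 := Submodule.inner_right_of_mem_orthogonal h3 (Kᗮ.sub_mem h2 hm')
  rw [inner_self_eq_zero, sub_eq_zero] at h4
  exact h4

variable {r : ℕ} {W : Type} [Fintype W] (len : W → ℕ) (wd : (w : W) → Fin (len w) → Fin r)

/-- the index set of the coefficient space -/
abbrev Idx (len : W → ℕ) : Type := (w : W) × ((Fin (len w) → Fin 3) × (Fin (len w) → Fin 3))

/-- the block of a coefficient vector -/
def blk (m : EuclideanSpace ℂ (Idx len)) (w : W) :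
    Matrix (Fin (len w) → Fin 3) (Fin (len w) → Fin 3) ℂ :=
  Matrix.of fun b a => m ⟨w, (b, a)⟩

/-- diagonal tensor power -/
abbrev tp (d : ℕ) (g : SL3) : Matrix (Fin d → Fin 3) (Fin d → Fin 3) ℂ :=
  tens (fun _ => (g : Matrix (Fin 3) (Fin 3) ℂ))

lemma tp_mul_inv (d : ℕ) (g : SL3) : tp d g * tp d g⁻¹ = 1 := by
  rw [tp, tp, ← tens_mul, ← tens_one]
  congr 1
  funext _
  rw [← Matrix.SpecialLinearGroup.coe_mul, mul_inv_cancel, Matrix.SpecialLinearGroup.coe_one]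

lemma tp_inv_mul (d : ℕ) (g : SL3) : tp d g⁻¹ * tp d g = 1 := by
  rw [tp, tp, ← tens_mul, ← tens_one]
  congr 1
  funext _
  rw [← Matrix.SpecialLinearGroup.coe_mul, inv_mul_cancel, Matrix.SpecialLinearGroup.coe_one]

/-- conjugate transpose in `SL3` -/
def stSL (g : SL3) : SL3 := ⟨(g : Matrix (Fin 3) (Fin 3) ℂ).conjTranspose, by
  rw [Matrix.det_conjTranspose, g.det_coe, star_one]⟩

lemma tp_stSL (d : ℕ) (g : SL3) : tp d (stSL g) = (tp d g).conjTranspose :=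
  tens_conjTranspose _

lemma tp_stSL_inv (d : ℕ) (g : SL3) : tp d (stSL g)⁻¹ = (tp d g⁻¹).conjTranspose := by
  have h1 : tp d (stSL g) * (tp d g⁻¹).conjTranspose = 1 := by
    rw [tp_stSL, ← Matrix.conjTranspose_mul, tp_inv_mul, Matrix.conjTranspose_one]
  have h2 := tp_inv_mul d (stSL g)
  calc tp d (stSL g)⁻¹ = tp d (stSL g)⁻¹ * (tp d (stSL g) * (tp d g⁻¹).conjTranspose) := by
        rw [h1, mul_one]
    _ = _ := by rw [← mul_assoc, h2, one_mul]

/-- action on coefficients -/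
def rhoC (g : SL3) : EuclideanSpace ℂ (Idx len) →ₗ[ℂ] EuclideanSpace ℂ (Idx len) where
  toFun m := WithLp.toLp 2 fun i =>
    (tp (len i.1) g⁻¹ * blk len m i.1 * tp (len i.1) g : Matrix _ _ ℂ) i.2.1 i.2.2
  map_add' x y := by
    ext i
    have : blk len (x + y) i.1 = blk len x i.1 + blk len y i.1 := rfl
    simp [this, mul_add, add_mul]
  map_smul' c x := by
    ext i
    have : blk len (c • x) i.1 = c • blk len x i.1 := rfl
    simp [this]

lemma blk_rhoC (g : SL3) (m : EuclideanSpace ℂ (Idx len)) (w : W) :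
    blk len (rhoC len g m) w = tp _ g⁻¹ * blk len m w * tp _ g := rfl

lemma inner_blk (x y : EuclideanSpace ℂ (Idx len)) :
    inner ℂ x y = ∑ w, ((blk len x w).conjTranspose * blk len y w).trace := by
  rw [PiLp.inner_apply, Fintype.sum_sigma]
  refine Finset.sum_congr rfl fun w _ => ?_
  rw [Fintype.sum_prod_type, Finset.sum_comm]
  simp only [Matrix.trace, Matrix.diag_apply, Matrix.mul_apply, Matrix.conjTranspose_apply]
  refine Finset.sum_congr rfl fun a _ => Finset.sum_congr rfl fun b _ => ?_
  simp [blk, mul_comm]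

lemma rhoC_adj (g : SL3) (x y : EuclideanSpace ℂ (Idx len)) :
    inner ℂ x (rhoC len g y) = inner ℂ (rhoC len (stSL g) x) y := by
  rw [inner_blk, inner_blk]
  refine Finset.sum_congr rfl fun w _ => ?_
  rw [blk_rhoC, blk_rhoC, tp_stSL_inv, tp_stSL]
  simp only [Matrix.conjTranspose_mul, Matrix.conjTranspose_conjTranspose]
  rw [mul_assoc, mul_assoc, Matrix.trace_mul_comm (tp _ g)]
  simp only [mul_assoc]

/-- evaluation of coefficients at a point -/
def evC (X : Fin r → SL3) : EuclideanSpace ℂ (Idx len) →ₗ[ℂ] ℂ where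
  toFun m := ∑ w, (blk len m w * tens (fun j => (X (wd w j) : Matrix (Fin 3) (Fin 3) ℂ))).trace
  map_add' x y := by
    have : ∀ w, blk len (x + y) w = blk len x w + blk len y w := fun _ => rfl
    simp [this, add_mul, Finset.sum_add_distrib]
  map_smul' c x := by
    have : ∀ w, blk len (c • x) w = c • blk len x w := fun _ => rfl
    simp [this, Finset.mul_sum]

lemma evC_apply (X : Fin r → SL3) (m : EuclideanSpace ℂ (Idx len)) :
    evC len wd X m =
      ∑ w, (blk len m w * tens (fun j => (X (wd w j) : Matrix (Fin 3) (Fin 3) ℂ))).trace := rfl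

lemma evC_act (g : SL3) (X : Fin r → SL3) (m : EuclideanSpace ℂ (Idx len)) :
    evC len wd (fun i => g * X i * g⁻¹) m = evC len wd X (rhoC len g m) := by
  show ∑ w, _ = ∑ w, _
  refine Finset.sum_congr rfl fun w _ => ?_
  rw [blk_rhoC]
  have : tens (fun j => ((g * X (wd w j) * g⁻¹ : SL3) : Matrix (Fin 3) (Fin 3) ℂ)) =
      tp _ g * tens (fun j => (X (wd w j) : Matrix (Fin 3) (Fin 3) ℂ)) * tp _ g⁻¹ := by
    simp only [Matrix.SpecialLinearGroup.coe_mul, tens_mul]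
  rw [this, ← mul_assoc, Matrix.trace_mul_comm]
  simp only [mul_assoc]

end Reynolds

lemma evW_list {r : ℕ} (X : Fin r → SL3) (w : FreeSemigroup (Fin r)) :
    evW (fun i (X : Fin r → SL3) => (X i : Matrix (Fin 3) (Fin 3) ℂ)) w X =
      ((((w.head :: w.tail).map X).prod : SL3) : Matrix (Fin 3) (Fin 3) ℂ) := by
  rcases w with ⟨s, l⟩
  induction l generalizing s with
  | nil =>
    have : (⟨s, []⟩ : FreeSemigroup (Fin r)) = FreeSemigroup.of s := rfl
    rw [this]
    simp [evW]
  | cons t l ih =>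
    have : (⟨s, t :: l⟩ : FreeSemigroup (Fin r)) = FreeSemigroup.of s * ⟨t, l⟩ := rfl
    rw [this, evW_mul, ih]
    simp [evW]

lemma exists_coeffs {r : ℕ} (P : MvPolynomial (Fin r × Fin 3 × Fin 3) ℂ) :
    ∃ (W : Type) (_ : Fintype W) (len : W → ℕ) (wd : (w : W) → Fin (len w) → Fin r)
      (m : EuclideanSpace ℂ (Idx len)), ∀ X : Fin r → SL3,
      MvPolynomial.eval (fun p => (X p.1 : Matrix (Fin 3) (Fin 3) ℂ) p.2.1 p.2.2) P
        = evC len wd X m := by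
  classical
  let W := {s // s ∈ P.support}
  let ls : W → List (Fin r × Fin 3 × Fin 3) := fun s => (Finsupp.toMultiset s.1).toList
  let len : W → ℕ := fun s => (ls s).length
  let wd : (w : W) → Fin (len w) → Fin r := fun s j => ((ls s)[j.1]).1
  let m : EuclideanSpace ℂ (Idx len) := WithLp.toLp 2 fun i =>
    (Matrix.single (fun j : Fin (len i.1) => ((ls i.1)[j.1]).2.2)
      (fun j : Fin (len i.1) => ((ls i.1)[j.1]).2.1) (P.coeff i.1.1) : Matrix _ _ ℂ) i.2.1 i.2.2
  refine ⟨W, inferInstance, len, wd, m, fun X => ?_⟩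
  rw [MvPolynomial.eval_eq, ← Finset.sum_coe_sort, evC_apply]
  refine Finset.sum_congr rfl fun s _ => ?_
  have hb : blk len m s = Matrix.single (fun j : Fin (len s) => ((ls s)[j.1]).2.2)
      (fun j : Fin (len s) => ((ls s)[j.1]).2.1) (P.coeff s.1) := rfl
  rw [hb, Matrix.trace_single_mul, tens_apply, smul_eq_mul]
  congr 1
  have := Fin.prod_univ_fun_getElem (ls s)
    (fun p => (X p.1 : Matrix (Fin 3) (Fin 3) ℂ) p.2.1 p.2.2)
  refine Eq.trans ?_ this.symm
  rw [Multiset.prod_map_toList, Finsupp.toMultiset_map, Finsupp.prod_toMultiset,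
    Finsupp.prod_mapDomain_index (by simp) (by intros; rw [pow_add])]
  rfl

/-- Every conjugation-invariant polynomial function on SL(3,ℂ)^r is a polynomial
in the traces of words of length at most 6 in the matrices X₁,…,X_r and their
inverses.  A word is encoded as a list of letters `(k, b) : Fin r × Bool`, the
letter being `X_k` if `b = false` and `X_k⁻¹` if `b = true`. -/
theorem invariants_generated_by_traces_of_words_of_length_at_most_six
    (r : ℕ) (hr : 1 ≤ r) (f : (Fin r → SL3) → ℂ)
    (hpoly : ∃ P : MvPolynomial (Fin r × Fin 3 × Fin 3) ℂ,
      ∀ X : Fin r → SL3,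
        f X = MvPolynomial.eval
          (fun p => (X p.1 : Matrix (Fin 3) (Fin 3) ℂ) p.2.1 p.2.2) P)
    (hinv : ∀ g : SL3, ∀ X : Fin r → SL3, f (fun i => g * X i * g⁻¹) = f X) :
    f ∈ Algebra.adjoin ℂ
      {h : (Fin r → SL3) → ℂ | ∃ l : List (Fin r × Bool),
        1 ≤ l.length ∧ l.length ≤ 6 ∧
        h = fun X => Matrix.trace
          (((l.map (fun p => if p.2 then (X p.1)⁻¹ else X p.1)).prod :
              SL3) : Matrix (Fin 3) (Fin 3) ℂ)} := by
  set A := Algebra.adjoin ℂ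
      {h : (Fin r → SL3) → ℂ | ∃ l : List (Fin r × Bool),
        1 ≤ l.length ∧ l.length ≤ 6 ∧
        h = fun X => Matrix.trace
          (((l.map (fun p => if p.2 then (X p.1)⁻¹ else X p.1)).prod :
              SL3) : Matrix (Fin 3) (Fin 3) ℂ)} with hAdef
  let M : Fin r → (Fin r → SL3) → Matrix (Fin 3) (Fin 3) ℂ := fun i X => X i
  have hA6 : ∀ w : FreeSemigroup (Fin r), w.length ≤ 6 → trW M w ∈ A := by
    intro w hw
    apply Algebra.subset_adjoin
    refine ⟨(w.head :: w.tail).map (fun i => (i, false)), ?_, ?_, ?_⟩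
    · simp
    · simpa [FreeSemigroup.length] using hw
    · funext X
      show (evW M w X).trace = _
      rw [evW_list, List.map_map]
      rfl
  have hA := trW_mem M A hA6
  have hperm := permTr_mem M A hA
  obtain ⟨P, hP⟩ := hpoly
  obtain ⟨W, _, len, wd, m, hm⟩ := exists_coeffs P
  obtain ⟨m', hm', hev⟩ := unitary_trick (T := Fin r → SL3) (rhoC len) stSL (rhoC_adj len)
    (evC len wd) (fun g X i => g * X i * g⁻¹) (evC_act len wd) m (by
      intro g X
      have hfe : ∀ X, evC len wd X m = f X := fun X => by rw [← hm, ← hP]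
      exact ((hfe _).trans (hinv g X)).trans (hfe X).symm)
  have hspan : ∀ w, blk len m' w ∈ Submodule.span ℂ (Set.range (permM (d := len w))) := by
    intro w
    apply double_commutant
    apply commute_symmetric
    apply comm_all
    intro g
    have h1 : tp _ g⁻¹ * blk len m' w * tp _ g = blk len m' w := by
      rw [← blk_rhoC, hm']
    calc blk len m' w * tp _ g = (tp _ g * tp _ g⁻¹) * (blk len m' w * tp _ g) := by
          rw [tp_mul_inv, one_mul]
      _ = tp _ g * (tp _ g⁻¹ * blk len m' w * tp _ g) := by simp only [mul_assoc]
      _ = tp _ g * blk len m' w := by rw [h1]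
  have key : ∀ (d : ℕ) (v : Fin d → Fin r) (U : Matrix (Fin d → Fin 3) (Fin d → Fin 3) ℂ),
      U ∈ Submodule.span ℂ (Set.range (permM (d := d))) →
      (fun X : Fin r → SL3 =>
        (U * tens (fun j => (X (v j) : Matrix (Fin 3) (Fin 3) ℂ))).trace) ∈ A := by
    intro d v U hU
    induction hU using Submodule.span_induction with
    | mem x hx =>
      obtain ⟨σ, rfl⟩ := hx
      have := hperm d (fun j => FreeSemigroup.of (v j)) σ⁻¹
      convert this using 1
      funext X
      rw [trace_permM_tens]
      simp [permTr, evW, M]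
    | zero =>
      simp only [zero_mul, Matrix.trace_zero]
      exact A.zero_mem
    | add x y _ _ hx hy =>
      simp only [add_mul, Matrix.trace_add]
      exact A.add_mem hx hy
    | smul c x _ hx =>
      simp only [smul_mul_assoc, Matrix.trace_smul]
      exact A.smul_mem hx c
  have hf : f = ∑ w, fun X : Fin r → SL3 =>
      (blk len m' w * tens (fun j => (X (wd w j) : Matrix (Fin 3) (Fin 3) ℂ))).trace := by
    funext X
    rw [hP, hm, ← hev, Finset.sum_apply]
    rfl
  rw [hf]
  exact A.sum_mem fun w _ => key _ _ _ (hspan w)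
end

section
/- Let r ≥ 3 be a natural number. The following 9r−8 functions on (Mat₃(ℂ))^r = (Matrix (Fin 3) ℂ)^r are algebraically independent over ℂ in the ℂ-algebra of all functions (Mat₃(ℂ))^r → ℂ: tr(X₁), tr(X₂), tr(X₁²), tr(X₂²), tr(X₁³), tr(X₂³), tr(X₁X₂), tr(X₁²X₂), tr(X₂²X₁), tr(X₁²X₂²), together with, for each k with 3 ≤ k ≤ r, the nine functions tr(X_k), tr(X_k²), tr(X_k³), tr(X₁X_k), tr(X₂X_k), tr(X₁X_k²), tr(X₁²X_k²), tr(X₁²X_k), tr(X₂²X_k²). -/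
/-- `Mat₃(ℂ)`, the full ring of 3×3 complex matrices. -/
abbrev M3 := Matrix (Fin 3) (Fin 3) ℂ

/-- If finitely many functions are strictly differentiable at a point with jointly surjective
derivative, they are algebraically independent. -/
theorem algInd_of_surj {E ι : Type*} [NormedAddCommGroup E] [NormedSpace ℂ E] [CompleteSpace E]
    [Fintype ι] (F : ι → E → ℂ) (x : E) (L : ι → (E →L[ℂ] ℂ))
    (hF : ∀ i, HasStrictFDerivAt (F i) (L i) x)
    (hs : ∀ w : ι → ℂ, ∃ D : E, ∀ i, L i D = w i) :
    AlgebraicIndependent ℂ F := by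
  rw [algebraicIndependent_iff]
  intro p hp
  have h1 : HasStrictFDerivAt (fun y i => F i y) (ContinuousLinearMap.pi L) x :=
    hasStrictFDerivAt_pi.2 hF
  have h2 := h1.map_nhds_eq_of_surj (by
    refine LinearMap.range_eq_top.2 fun w => ?_
    obtain ⟨D, hD⟩ := hs w
    exact ⟨D, funext hD⟩)
  have h3 : Set.range (fun y i => F i y) ∈ nhds (fun i => F i x) := by
    rw [← h2]
    exact Filter.mem_map.2 (Filter.univ_mem' fun y => ⟨y, rfl⟩)
  obtain ⟨ε, hε, hb⟩ := Metric.mem_nhds_iff.1 h3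
  refine MvPolynomial.funext_set (fun i => Metric.ball (F i x) ε) (fun i => ?_) (fun z hz => ?_)
  · exact infinite_of_mem_nhds (F i x) (Metric.ball_mem_nhds _ hε)
  · have : z ∈ Metric.ball (fun i => F i x) ε := by
      rw [Metric.mem_ball, dist_pi_lt_iff hε]
      intro i
      exact hz i (Set.mem_univ i)
    obtain ⟨y, rfl⟩ := hb this
    have h4 := congrFun hp y
    have h5 : (Pi.evalAlgHom ℂ (fun _ : E => ℂ) y) (MvPolynomial.aeval F p) = 0 := h4
    rw [MvPolynomial.comp_aeval_apply] at h5
    rw [map_zero]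
    exact h5

section Deriv

attribute [local instance] Matrix.linftyOpNormedRing Matrix.linftyOpNormedAlgebra

/-- `f` has strict derivative `d` at `x`. -/
def HD {r : ℕ} (f : (Fin r → M3) → M3) (x : Fin r → M3) (d : (Fin r → M3) → M3) : Prop :=
  ∃ L : (Fin r → M3) →L[ℂ] M3, HasStrictFDerivAt f L x ∧ ∀ D, L D = d D

/-- `f` has strict derivative `d` at `x` (scalar version). -/
def HC {r : ℕ} (f : (Fin r → M3) → ℂ) (x : Fin r → M3) (d : (Fin r → M3) → ℂ) : Prop :=
  ∃ L : (Fin r → M3) →L[ℂ] ℂ, HasStrictFDerivAt f L x ∧ ∀ D, L D = d D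

theorem HD.proj {r : ℕ} (k : Fin r) (x : Fin r → M3) :
    HD (fun X : Fin r → M3 => X k) x (fun D => D k) :=
  ⟨ContinuousLinearMap.proj k, hasStrictFDerivAt_apply k x, fun _ => rfl⟩

theorem HD.mul {r : ℕ} {f g : (Fin r → M3) → M3} {x : Fin r → M3}
    {d e : (Fin r → M3) → M3} (hf : HD f x d) (hg : HD g x e) :
    HD (fun y => f y * g y) x (fun D => f x * e D + d D * g x) := by
  obtain ⟨L, hL, hd⟩ := hf
  obtain ⟨M, hM, he⟩ := hg
  exact ⟨_, hL.mul' hM, fun D => by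
    change f x * M D + L D * g x = f x * e D + d D * g x
    rw [hd, he]⟩

theorem HD.sq {r : ℕ} {f : (Fin r → M3) → M3} {x : Fin r → M3}
    {d : (Fin r → M3) → M3} (hf : HD f x d) :
    HD (fun y => f y ^ 2) x (fun D => f x * d D + d D * f x) := by
  simpa only [pow_two] using hf.mul hf

theorem HD.cube {r : ℕ} {f : (Fin r → M3) → M3} {x : Fin r → M3}
    {d : (Fin r → M3) → M3} (hf : HD f x d) :
    HD (fun y => f y ^ 3) x (fun D => f x ^ 2 * d D + (f x * d D + d D * f x) * f x) := by
  simpa only [pow_succ _ 2] using hf.sq.mul hf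

theorem HD.trace {r : ℕ} {f : (Fin r → M3) → M3} {x : Fin r → M3}
    {d : (Fin r → M3) → M3} (hf : HD f x d) :
    HC (fun y => Matrix.trace (f y)) x (fun D => Matrix.trace (d D)) := by
  obtain ⟨L, hL, hd⟩ := hf
  refine ⟨(LinearMap.toContinuousLinearMap (Matrix.traceLinearMap (Fin 3) ℂ ℂ)).comp L,
    (LinearMap.toContinuousLinearMap (Matrix.traceLinearMap (Fin 3) ℂ ℂ)).hasStrictFDerivAt.comp
      x hL, fun D => ?_⟩
  change Matrix.trace (L D) = Matrix.trace (d D)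
  rw [hd]

theorem algInd_of_HD {r : ℕ} {ι : Type*} [Fintype ι] (F : ι → (Fin r → M3) → ℂ) (x : Fin r → M3)
    (d : ι → (Fin r → M3) → ℂ) (hF : ∀ i, HC (F i) x (d i))
    (hs : ∀ w : ι → ℂ, ∃ D, ∀ i, d i D = w i) :
    AlgebraicIndependent ℂ F := by
  choose L hL hd using hF
  refine algInd_of_surj F x L hL fun w => ?_
  obtain ⟨D, hD⟩ := hs w
  exact ⟨D, fun i => (hd i D).trans (hD i)⟩

end Deriv

/-- base point, first matrix -/
def pA : M3 := !![0, 0, 0; 0, 1, 0; 0, 0, -1]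
/-- base point, second matrix -/
def pB : M3 := !![0, 0, -1; 1, 0, -1; 0, 1, 0]
/-- base point, other matrices -/
def pC : M3 := !![0, 1, 0; 0, 0, 1; 1, -1, 0]

/-- derivative of the square -/
def dsq (X D : M3) : M3 := X * D + D * X
/-- derivative of the cube -/
def dcu (X D : M3) : M3 := X ^ 2 * D + (X * D + D * X) * X

theorem pA_sq : pA ^ 2 = !![0, 0, 0; 0, 1, 0; 0, 0, 1] := by
  ext i j
  fin_cases i <;> fin_cases j <;>
    simp [pA, pow_two, Matrix.mul_apply, Fin.sum_univ_three]
theorem pB_sq : pB ^ 2 = !![0, -1, 0; 0, -1, -1; 1, 0, -1] := by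
  ext i j
  fin_cases i <;> fin_cases j <;>
    simp [pB, pow_two, Matrix.mul_apply, Fin.sum_univ_three]
theorem pC_sq : pC ^ 2 = !![0, 0, 1; 1, -1, 0; 0, 1, -1] := by
  ext i j
  fin_cases i <;> fin_cases j <;>
    simp [pC, pow_two, Matrix.mul_apply, Fin.sum_univ_three]

set_option maxHeartbeats 1000000 in
theorem solveC (v : Fin 9 → ℂ) : ∃ D : M3,
    Matrix.trace D = v 0 ∧
    Matrix.trace (dsq pC D) = v 1 ∧
    Matrix.trace (dcu pC D) = v 2 ∧
    Matrix.trace (pA * D) = v 3 ∧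
    Matrix.trace (pB * D) = v 4 ∧
    Matrix.trace (pA * dsq pC D) = v 5 ∧
    Matrix.trace (pA ^ 2 * dsq pC D) = v 6 ∧
    Matrix.trace (pA ^ 2 * D) = v 7 ∧
    Matrix.trace (pB ^ 2 * dsq pC D) = v 8 := by
  refine ⟨!![(1)*v 0 + (-1)*v 7, (-1/2)*v 1 + (1)*v 4 + (1/2)*v 6 + (1/2)*v 7 + (-1/2)*v 8, (1/2)*v 1 + (-1/2)*v 5 + (-1/2)*v 6;
    (1/2)*v 1 + (1/2)*v 5 + (-1/2)*v 6, (1/2)*v 3 + (1/2)*v 7, (1/2)*v 1 + (1/3)*v 2 + (-1)*v 4 + (1)*v 8;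
    (-1/2)*v 6 + (1/2)*v 7 + (-1/2)*v 8, (1/3)*v 2 + (-1)*v 4 + (1)*v 6 + (1)*v 8, (-1/2)*v 3 + (1/2)*v 7], ?_⟩
  refine ⟨?_, ?_, ?_, ?_, ?_, ?_, ?_, ?_, ?_⟩ <;>
  · try simp only [dsq, dcu, pA_sq, pB_sq, pC_sq]
    try simp only [pA, pB, pC]
    simp [Matrix.trace_fin_three, Matrix.mul_apply, Fin.sum_univ_three]
    try ring

set_option maxHeartbeats 1000000 in
theorem solveAB (u : Fin 10 → ℂ) : ∃ S T : M3,
    Matrix.trace S = u 0 ∧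
    Matrix.trace T = u 1 ∧
    Matrix.trace (dsq pA S) = u 2 ∧
    Matrix.trace (dsq pB T) = u 3 ∧
    Matrix.trace (dcu pA S) = u 4 ∧
    Matrix.trace (dcu pB T) = u 5 ∧
    Matrix.trace (pA * T + S * pB) = u 6 ∧
    Matrix.trace (pA ^ 2 * T + dsq pA S * pB) = u 7 ∧
    Matrix.trace (pB ^ 2 * S + dsq pB T * pA) = u 8 ∧
    Matrix.trace (pA ^ 2 * dsq pB T + dsq pA S * pB ^ 2) = u 9 := by
  refine ⟨!![(1)*u 0 + (-1/3)*u 4, 0, 0;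
    0, (1/4)*u 2 + (1/6)*u 4, 0;
    0, 0, (-1/4)*u 2 + (1/6)*u 4],
    !![(1)*u 1 + (-1)*u 7, (-1/2)*u 2 + (1/2)*u 3 + (1/6)*u 4 + (1/2)*u 8 + (-1/2)*u 9, (1/3)*u 5 + (1)*u 7;
    0, (1/2)*u 6 + (1/2)*u 7, (1)*u 2 + (-1/2)*u 3 + (1)*u 9;
    (1/2)*u 2 + (-1/2)*u 3 + (1/6)*u 4 + (1/2)*u 8 + (1/2)*u 9, 0, (-1/2)*u 6 + (1/2)*u 7], ?_⟩
  refine ⟨?_, ?_, ?_, ?_, ?_, ?_, ?_, ?_, ?_, ?_⟩ <;>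
  · try simp only [dsq, dcu, pA_sq, pB_sq, pC_sq]
    try simp only [pA, pB, pC]
    simp [Matrix.trace_fin_three, Matrix.mul_apply, Fin.sum_univ_three]
    try ring

/-- assemble a tuple from the first two matrices and the rest -/
def tup {r : ℕ} (a b : M3) (c : Fin r → M3) : Fin r → M3 := fun k =>
  if (k : ℕ) = 0 then a else if (k : ℕ) = 1 then b else c k

theorem tup_zero {r : ℕ} (a b : M3) (c : Fin r → M3) (h : 0 < r) : tup a b c ⟨0, h⟩ = a := by
  simp [tup]
theorem tup_one {r : ℕ} (a b : M3) (c : Fin r → M3) (h : 1 < r) : tup a b c ⟨1, h⟩ = b := by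
  simp [tup]
theorem tup_ge {r : ℕ} (a b : M3) (c : Fin r → M3) (k : Fin r) (h : 2 ≤ (k : ℕ)) :
    tup a b c k = c k := by
  have h0 : (k : ℕ) ≠ 0 := by omega
  have h1 : (k : ℕ) ≠ 1 := by omega
  simp [tup, h0, h1]

/-- The 9r−8 trace functions on (Mat₃(ℂ))^r (indices 0-based: X₁ = X 0,
X₂ = X 1, and the block for each k with 3 ≤ k ≤ r is indexed by k : Fin r with
2 ≤ k) are algebraically independent over ℂ. -/
theorem gl3_trace_functions_algebraically_independent
    (r : ℕ) (hr : 3 ≤ r) :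
    AlgebraicIndependent ℂ
      (Sum.elim
        (fun j : Fin 10 => fun X : Fin r → M3 =>
          ![Matrix.trace (X ⟨0, by omega⟩),
            Matrix.trace (X ⟨1, by omega⟩),
            Matrix.trace (X ⟨0, by omega⟩ ^ 2),
            Matrix.trace (X ⟨1, by omega⟩ ^ 2),
            Matrix.trace (X ⟨0, by omega⟩ ^ 3),
            Matrix.trace (X ⟨1, by omega⟩ ^ 3),
            Matrix.trace (X ⟨0, by omega⟩ * X ⟨1, by omega⟩),
            Matrix.trace (X ⟨0, by omega⟩ ^ 2 * X ⟨1, by omega⟩),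
            Matrix.trace (X ⟨1, by omega⟩ ^ 2 * X ⟨0, by omega⟩),
            Matrix.trace (X ⟨0, by omega⟩ ^ 2 * X ⟨1, by omega⟩ ^ 2)] j)
        (fun p : {k : Fin r // 2 ≤ (k : ℕ)} × Fin 9 => fun X : Fin r → M3 =>
          ![Matrix.trace (X p.1.1),
            Matrix.trace (X p.1.1 ^ 2),
            Matrix.trace (X p.1.1 ^ 3),
            Matrix.trace (X ⟨0, by omega⟩ * X p.1.1),
            Matrix.trace (X ⟨1, by omega⟩ * X p.1.1),
            Matrix.trace (X ⟨0, by omega⟩ * X p.1.1 ^ 2),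
            Matrix.trace (X ⟨0, by omega⟩ ^ 2 * X p.1.1 ^ 2),
            Matrix.trace (X ⟨0, by omega⟩ ^ 2 * X p.1.1),
            Matrix.trace (X ⟨1, by omega⟩ ^ 2 * X p.1.1 ^ 2)] p.2)) := by
  have h0 : 0 < r := by omega
  have h1 : 1 < r := by omega
  refine algInd_of_HD _ (tup pA pB fun _ => pC)
    (Sum.elim
      (fun j D => ![Matrix.trace (D ⟨0, h0⟩),
        Matrix.trace (D ⟨1, h1⟩),
        Matrix.trace (dsq pA (D ⟨0, h0⟩)),
        Matrix.trace (dsq pB (D ⟨1, h1⟩)),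
        Matrix.trace (dcu pA (D ⟨0, h0⟩)),
        Matrix.trace (dcu pB (D ⟨1, h1⟩)),
        Matrix.trace (pA * D ⟨1, h1⟩ + D ⟨0, h0⟩ * pB),
        Matrix.trace (pA ^ 2 * D ⟨1, h1⟩ + dsq pA (D ⟨0, h0⟩) * pB),
        Matrix.trace (pB ^ 2 * D ⟨0, h0⟩ + dsq pB (D ⟨1, h1⟩) * pA),
        Matrix.trace (pA ^ 2 * dsq pB (D ⟨1, h1⟩) + dsq pA (D ⟨0, h0⟩) * pB ^ 2)] j)
      (fun p D => ![Matrix.trace (D p.1.1),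
        Matrix.trace (dsq pC (D p.1.1)),
        Matrix.trace (dcu pC (D p.1.1)),
        Matrix.trace (pA * D p.1.1 + D ⟨0, h0⟩ * pC),
        Matrix.trace (pB * D p.1.1 + D ⟨1, h1⟩ * pC),
        Matrix.trace (pA * dsq pC (D p.1.1) + D ⟨0, h0⟩ * pC ^ 2),
        Matrix.trace (pA ^ 2 * dsq pC (D p.1.1) + dsq pA (D ⟨0, h0⟩) * pC ^ 2),
        Matrix.trace (pA ^ 2 * D p.1.1 + dsq pA (D ⟨0, h0⟩) * pC),
        Matrix.trace (pB ^ 2 * dsq pC (D p.1.1) + dsq pB (D ⟨1, h1⟩) * pC ^ 2)] p.2)) ?_ ?_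
  · have e0 : tup pA pB (fun _ => pC) (⟨0, h0⟩ : Fin r) = pA := tup_zero _ _ _ _
    have e1 : tup pA pB (fun _ => pC) (⟨1, h1⟩ : Fin r) = pB := tup_one _ _ _ _
    have d0 := HD.proj (⟨0, h0⟩ : Fin r) (tup pA pB fun _ => pC)
    have d1 := HD.proj (⟨1, h1⟩ : Fin r) (tup pA pB fun _ => pC)
    rintro (j | ⟨⟨k, hk⟩, j⟩)
    · have t0 := d0.trace
      have t1 := d1.trace
      have t2 := d0.sq.trace
      have t3 := d1.sq.trace
      have t4 := d0.cube.trace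
      have t5 := d1.cube.trace
      have t6 := (d0.mul d1).trace
      have t7 := (d0.sq.mul d1).trace
      have t8 := (d1.sq.mul d0).trace
      have t9 := (d0.sq.mul d1.sq).trace
      simp only [e0, e1] at t0 t1 t2 t3 t4 t5 t6 t7 t8 t9
      fin_cases j
      exacts [t0, t1, t2, t3, t4, t5, t6, t7, t8, t9]
    · have ek : tup pA pB (fun _ => pC) k = pC := tup_ge _ _ _ k hk
      have dk := HD.proj k (tup pA pB fun _ => pC)
      have t0 := dk.trace
      have t1 := dk.sq.trace
      have t2 := dk.cube.trace
      have t3 := (d0.mul dk).trace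
      have t4 := (d1.mul dk).trace
      have t5 := (d0.mul dk.sq).trace
      have t6 := (d0.sq.mul dk.sq).trace
      have t7 := (d0.sq.mul dk).trace
      have t8 := (d1.sq.mul dk.sq).trace
      simp only [e0, e1, ek] at t0 t1 t2 t3 t4 t5 t6 t7 t8
      fin_cases j
      exacts [t0, t1, t2, t3, t4, t5, t6, t7, t8]
  · intro w
    obtain ⟨S, T, hST⟩ := solveAB fun j => w (Sum.inl j)
    have hC := fun k : {k : Fin r // 2 ≤ (k : ℕ)} => solveC fun j => w (Sum.inr (k, j)) -
          ![0, 0, 0, Matrix.trace (S * pC), Matrix.trace (T * pC), Matrix.trace (S * pC ^ 2),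
            Matrix.trace (dsq pA S * pC ^ 2), Matrix.trace (dsq pA S * pC),
            Matrix.trace (dsq pB T * pC ^ 2)] j
    choose Dk hD using hC
    let D : Fin r → M3 := fun k => if hk : 2 ≤ (k : ℕ) then Dk ⟨k, hk⟩ else 0
    refine ⟨tup S T D, ?_⟩
    have e0 : tup S T D (⟨0, h0⟩ : Fin r) = S := tup_zero _ _ _ _
    have e1 : tup S T D (⟨1, h1⟩ : Fin r) = T := tup_one _ _ _ _
    rintro (j | ⟨⟨k, hk⟩, j⟩)
    · obtain ⟨t0, t1, t2, t3, t4, t5, t6, t7, t8, t9⟩ := hST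
      simp only [Sum.elim_inl, e0, e1]
      fin_cases j
      exacts [t0, t1, t2, t3, t4, t5, t6, t7, t8, t9]
    · have ek : tup S T D k = Dk ⟨k, hk⟩ := (tup_ge _ _ _ k hk).trans (dif_pos hk)
      obtain ⟨t0, t1, t2, t3, t4, t5, t6, t7, t8⟩ := hD ⟨k, hk⟩
      simp only [Sum.elim_inr, e0, e1, ek, Matrix.trace_add]
      fin_cases j
      exacts [t0.trans (sub_zero _), t1.trans (sub_zero _), t2.trans (sub_zero _),
        eq_sub_iff_add_eq.1 t3, eq_sub_iff_add_eq.1 t4, eq_sub_iff_add_eq.1 t5,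
        eq_sub_iff_add_eq.1 t6, eq_sub_iff_add_eq.1 t7, eq_sub_iff_add_eq.1 t8]
end

section
/- Let m ≥ 2 and r ≥ 1, and let W be a finite set of nonempty words in r letters with only positive exponents (i.e., elements of the free monoid on r generators) such that for every k ∈ {1,…,r} and every j with 1 ≤ j ≤ m−1, the word X_k^j belongs to W. Suppose that the trace functions (X₁,…,X_r) ↦ tr(w(X₁,…,X_r)), for w ∈ W, are algebraically independent over ℂ as functions on SL(m,ℂ)^r. Then the family of functions on (Mat_m(ℂ))^r consisting of the trace functions (X₁,…,X_r) ↦ tr(w(X₁,…,X_r)) for w ∈ W, together with the r functions (X₁,…,X_r) ↦ tr(X_k^m) for k = 1,…,r, is algebraically independent over ℂ as functions on (Mat_m(ℂ))^r. -/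
open Polynomial in
lemma aux_det_aeval {m : ℕ} (A : Matrix (Fin m) (Fin m) ℂ) (p : ℂ[X]) :
    (aeval A p).det = (A.charpoly.roots.map (fun a => p.eval a)).prod := by
  have hch : A.charpoly = (A.charpoly.roots.map (fun a => X - C a)).prod :=
    (IsAlgClosed.splits A.charpoly).eq_prod_roots_of_monic A.charpoly_monic
  have hcard : A.charpoly.roots.card = m := by
    rw [← (IsAlgClosed.splits A.charpoly).natDegree_eq_card_roots, A.charpoly_natDegree_eq_dim]
    simp
  have hlin : ∀ b : ℂ, (aeval A (X - C b)).det
      = (A.charpoly.roots.map (fun a => (X - C b).eval a)).prod := by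
    intro b
    have h1 : (Matrix.scalar (Fin m) b - A).det = A.charpoly.eval b :=
      (Matrix.eval_charpoly A b).symm
    have h2 : aeval A (X - C b) = -(Matrix.scalar (Fin m) b - A) := by
      simp [Matrix.algebraMap_eq_diagonal, Pi.algebraMap_def]
    have h3 : A.charpoly.eval b = (A.charpoly.roots.map (fun a => b - a)).prod := by
      conv_lhs => rw [hch]
      rw [eval_multiset_prod, Multiset.map_map]
      simp
    have h4 : ∀ s : Multiset ℂ, (-1) ^ s.card * (s.map (fun a => b - a)).prod
        = (s.map (fun a => a - b)).prod := by
      intro s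
      induction s using Multiset.induction_on with
      | empty => simp
      | cons a s ih =>
        simp only [Multiset.card_cons, Multiset.map_cons, Multiset.prod_cons, ← ih]
        ring
    rw [h2, Matrix.det_neg, h1, h3, Fintype.card_fin]
    have h5 := h4 A.charpoly.roots
    rw [hcard] at h5
    rw [h5]
    simp
  have hms : ∀ s : Multiset ℂ, (aeval A (s.map (fun b => X - C b)).prod).det
      = (A.charpoly.roots.map (fun a => ((s.map (fun b => X - C b)).prod).eval a)).prod := by
    intro s
    induction s using Multiset.induction_on with
    | empty => simp
    | cons b s ih =>
      simp only [Multiset.map_cons, Multiset.prod_cons, map_mul, Matrix.det_mul, ih, hlin,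
        eval_mul, Multiset.prod_map_mul]
  rw [(IsAlgClosed.splits p).eq_prod_roots]
  simp only [map_mul, Matrix.det_mul, hms, eval_mul, Multiset.prod_map_mul]
  simp [hcard, Matrix.algebraMap_eq_diagonal]

open Polynomial in
lemma aux_trace_pow {m : ℕ} (A : Matrix (Fin m) (Fin m) ℂ) (k : ℕ) :
    (A ^ k).trace = (A.charpoly.roots.map (fun a => a ^ k)).sum := by
  have h : (A ^ k).charpoly = ((A.charpoly.roots.map (fun a => a ^ k)).map (fun a => X - C a)).prod := by
    apply Polynomial.funext
    intro z
    have h1 := aux_det_aeval A (C z - X ^ k)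
    rw [Matrix.eval_charpoly, eval_multiset_prod, Multiset.map_map, Multiset.map_map]
    simp [Matrix.algebraMap_eq_diagonal, Pi.algebraMap_def] at h1
    simpa using h1
  rw [Matrix.trace_eq_sum_roots_charpoly, h, roots_multiset_prod_X_sub_C]

/-- eigenvalues as a family -/
lemma aux_eig {m : ℕ} (A : Matrix (Fin m) (Fin m) ℂ) :
    ∃ f : Fin m → ℂ, (∀ k, (A ^ k).trace = ∑ i, f i ^ k) ∧ A.det = ∏ i, f i := by
  have hcard : A.charpoly.roots.card = m := by
    rw [← (IsAlgClosed.splits A.charpoly).natDegree_eq_card_roots, A.charpoly_natDegree_eq_dim]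
    simp
  obtain ⟨f, hf⟩ : ∃ f : Fin m → ℂ, A.charpoly.roots = Finset.univ.val.map f := by
    generalize A.charpoly.roots = s at hcard
    subst hcard
    induction s using Quotient.inductionOn with
    | h l => exact ⟨fun i => l.get i, by
        change (l : Multiset ℂ) = Multiset.map (fun i : Fin l.length => l.get i) Finset.univ.val
        rw [Fin.univ_val_map, List.ofFn_get]⟩
  refine ⟨f, fun k => ?_, ?_⟩
  · rw [aux_trace_pow, hf, Multiset.map_map]; rfl
  · rw [Matrix.det_eq_prod_roots_charpoly, hf]; rfl

open MvPolynomial in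
lemma aux_esymm_mem (m n : ℕ) : ∀ k, k < n →
    esymm (Fin m) ℂ k ∈ Algebra.adjoin ℂ (Set.range fun j : Fin (n-1) => psum (Fin m) ℂ (j+1)) := by
  intro k
  induction k using Nat.strong_induction_on with
  | _ k ih =>
  intro hk
  rcases Nat.eq_zero_or_pos k with rfl | hpos
  · simp [one_mem]
  have h := mul_esymm_eq_sum (Fin m) ℂ k
  have h2 : esymm (Fin m) ℂ k = ((k:ℂ)⁻¹) • ((-1) ^ (k + 1) *
      ∑ a ∈ Finset.HasAntidiagonal.antidiagonal k with a.1 < k, (-1) ^ a.1 * esymm (Fin m) ℂ a.1 * psum (Fin m) ℂ a.2) := by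
    rw [← h, ← nsmul_eq_mul, ← Nat.cast_smul_eq_nsmul ℂ, smul_smul, inv_mul_cancel₀, one_smul]
    exact_mod_cast hpos.ne'
  rw [h2]
  have hneg : (-1 : MvPolynomial (Fin m) ℂ) ∈ Algebra.adjoin ℂ (Set.range fun j : Fin (n-1) => psum (Fin m) ℂ (j+1)) := neg_mem (one_mem _)
  refine Subalgebra.smul_mem _ (mul_mem (pow_mem hneg _) (sum_mem ?_)) _
  rintro ⟨a, b⟩ hab
  simp only [Finset.mem_filter, Finset.HasAntidiagonal.mem_antidiagonal] at hab
  refine mul_mem (mul_mem (pow_mem hneg _) (ih a hab.2 (by omega))) (Algebra.subset_adjoin ⟨⟨b-1, by omega⟩, ?_⟩)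
  simp only
  congr 1
  omega

open MvPolynomial in
lemma aux_newton (m : ℕ) (hm : 0 < m) : ∃ q : MvPolynomial (Fin (m-1)) ℂ, ∃ c : ℂ, c ≠ 0 ∧
    ∀ A : Matrix (Fin m) (Fin m) ℂ, (A ^ m).trace =
      eval (fun j : Fin (m-1) => (A ^ ((j:ℕ)+1)).trace) q + c * A.det := by
  have h := psum_eq_mul_esymm_sub_sum (Fin m) ℂ m hm
  have hneg : (-1 : MvPolynomial (Fin m) ℂ) ∈ Algebra.adjoin ℂ (Set.range fun j : Fin (m-1) => psum (Fin m) ℂ (j+1)) := neg_mem (one_mem _)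
  have hmem : -∑ a ∈ Finset.HasAntidiagonal.antidiagonal m with a.1 ∈ Set.Ioo 0 m, (-1) ^ a.1 * esymm (Fin m) ℂ a.1 * psum (Fin m) ℂ a.2 ∈ Algebra.adjoin ℂ (Set.range fun j : Fin (m-1) => psum (Fin m) ℂ (j+1)) := by
    refine neg_mem (sum_mem ?_)
    rintro ⟨a, b⟩ hab
    simp only [Finset.mem_filter, Finset.HasAntidiagonal.mem_antidiagonal, Set.mem_Ioo] at hab
    refine mul_mem (mul_mem (pow_mem hneg _) (aux_esymm_mem m m a (by omega))) (Algebra.subset_adjoin ⟨⟨b-1, by omega⟩, ?_⟩)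
    simp only
    congr 1
    omega
  rw [Algebra.adjoin_range_eq_range_aeval] at hmem
  obtain ⟨q, hq⟩ := hmem
  refine ⟨q, (-1)^(m+1) * m, by simp; omega, fun A => ?_⟩
  obtain ⟨f, hf, hd⟩ := aux_eig A
  replace hq : aeval (fun j : Fin (m-1) => psum (Fin m) ℂ (j+1)) q = _ := hq
  rw [sub_eq_add_neg, ← hq] at h
  have h3 := congrArg (eval f) h
  have h4 : eval f (esymm (Fin m) ℂ m) = ∏ i, f i := by
    have : Finset.powersetCard m (Finset.univ : Finset (Fin m)) = {Finset.univ} := by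
      have h6 := Finset.powersetCard_self (Finset.univ : Finset (Fin m))
      rwa [Finset.card_univ, Fintype.card_fin] at h6
    simp [esymm, this]
  have h5 : eval f (aeval (fun j : Fin (m-1) => psum (Fin m) ℂ (j+1)) q)
      = eval (fun j : Fin (m-1) => (A ^ ((j:ℕ)+1)).trace) q := by
    rw [← coe_aeval_eq_eval, RingHom.coe_coe, ← AlgHom.comp_apply, comp_aeval, ← coe_aeval_eq_eval, RingHom.coe_coe]
    congr 2
    funext j
    simp [psum, hf]
  rw [map_add, h5, map_mul, h4] at h3
  rw [hd, hf, add_comm]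
  simpa [psum] using h3

lemma aux_aeval_fun {σ Ω : Type*} (T : σ → Ω → ℂ) (P : MvPolynomial σ ℂ) (Y : Ω) :
    (MvPolynomial.aeval T P) Y = MvPolynomial.eval (fun i => T i Y) P := by
  induction P using MvPolynomial.induction_on with
  | C a => simp
  | add p q hp hq => simp [hp, hq]
  | mul_X p i hp => simp [hp]

lemma aux_lift_smul {m r : ℕ} (c : Fin r → ℂ) (Y : Fin r → Matrix (Fin m) (Fin m) ℂ)
    (w : FreeMonoid (Fin r)) : FreeMonoid.lift (fun k => c k • Y k) w =
      FreeMonoid.lift c w • FreeMonoid.lift Y w := by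
  induction w using FreeMonoid.inductionOn' with
  | one => simp
  | of_mul x w ih => simp [ih, smul_smul, mul_comm, mul_left_comm]

open MvPolynomial in
/-- Pulling back Procesi parameters: if the traces of a finite set W of nonempty
positive words (containing each X_k^j for 1 ≤ j ≤ m−1) are algebraically
independent as functions on SL(m,ℂ)^r, then these trace functions together with
the r functions tr(X_k^m) are algebraically independent as functions on
(Mat_m(ℂ))^r. -/
theorem procesi_parameters_pull_back
    (m r : ℕ) (hm : 2 ≤ m) (hr : 1 ≤ r)
    (W : Finset (FreeMonoid (Fin r)))
    (hW : ∀ w ∈ W, w ≠ 1)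
    (hpow : ∀ k : Fin r, ∀ j : ℕ, 1 ≤ j → j ≤ m - 1 → (FreeMonoid.of k) ^ j ∈ W)
    (hind : AlgebraicIndependent ℂ
      (fun w : W => fun X : Fin r → Matrix.SpecialLinearGroup (Fin m) ℂ =>
        Matrix.trace
          (FreeMonoid.lift (fun k => (X k : Matrix (Fin m) (Fin m) ℂ)) w.1))) :
    AlgebraicIndependent ℂ
      (Sum.elim
        (fun w : W => fun X : Fin r → Matrix (Fin m) (Fin m) ℂ =>
          Matrix.trace (FreeMonoid.lift X w.1))
        (fun k : Fin r => fun X : Fin r → Matrix (Fin m) (Fin m) ℂ =>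
          Matrix.trace (X k ^ m))) := by
  obtain ⟨q, c, hc, hq⟩ := aux_newton m (by omega)
  rw [algebraicIndependent_iff] at hind ⊢
  intro p hp
  have hev : ∀ X : Fin r → Matrix (Fin m) (Fin m) ℂ,
      eval (Sum.elim (fun w : W => Matrix.trace (FreeMonoid.lift X w.1))
        (fun k => Matrix.trace (X k ^ m))) p = 0 := by
    intro X
    have h := congrArg (Pi.evalAlgHom ℂ (fun _ => ℂ) X) hp
    rw [← AlgHom.comp_apply, comp_aeval, map_zero] at h
    rw [← h, ← coe_aeval_eq_eval, RingHom.coe_coe]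
    congr 2
    funext i
    cases i <;> rfl
  let ι : Fin r → Fin (m-1) → W := fun k j =>
    ⟨FreeMonoid.of k ^ ((j:ℕ)+1), hpow k _ (by omega) (by omega)⟩
  -- key vanishing
  have key : ∀ (y : W → ℂ) (l : Fin r → ℂ), (∀ k, l k ≠ 0) →
      eval (Sum.elim y (fun k => eval (fun j => y (ι k j)) q + c * l k ^ m)) p = 0 := by
    intro y l hl
    have hd : ∀ w : FreeMonoid (Fin r), FreeMonoid.lift l w ≠ 0 := by
      intro w
      induction w using FreeMonoid.inductionOn' with
      | one => simp
      | of_mul x w ih => simp [ih, hl]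
    let g : W ⊕ Fin r → MvPolynomial W ℂ := Sum.elim (fun w => C (FreeMonoid.lift l w.1) * X w)
      (fun k => aeval (fun j => C (FreeMonoid.lift l (ι k j).1) * X (ι k j)) q + C (c * l k ^ m))
    have hg : ∀ y : W → ℂ, eval y (aeval g p) = eval (Sum.elim (fun w => FreeMonoid.lift l w.1 * y w)
        (fun k => eval (fun j => FreeMonoid.lift l (ι k j).1 * y (ι k j)) q + c * l k ^ m)) p := by
      intro y
      have hcomp : ∀ {σ : Type} (φ : σ → MvPolynomial W ℂ) (p : MvPolynomial σ ℂ),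
          eval y (aeval φ p) = eval (fun i => eval y (φ i)) p := by
        intro σ φ p
        rw [← coe_aeval_eq_eval, RingHom.coe_coe, ← AlgHom.comp_apply, comp_aeval,
          ← coe_aeval_eq_eval, RingHom.coe_coe]
      rw [hcomp]
      congr 2
      funext i
      cases i with
      | inl w => simp [g]
      | inr k => simp only [g, Sum.elim_inr, map_add, hcomp, map_mul, eval_C, eval_X]
    have hzero : aeval g p = 0 := by
      apply hind
      funext Y
      have h := hev (fun k => l k • (Y k : Matrix (Fin m) (Fin m) ℂ))
      have h' := hg (fun w => Matrix.trace (FreeMonoid.lift (fun k => (Y k : Matrix (Fin m) (Fin m) ℂ)) w.1))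
      have hb : ∀ P : MvPolynomial W ℂ, (aeval (fun w : W => fun X : Fin r → Matrix.SpecialLinearGroup (Fin m) ℂ =>
        Matrix.trace (FreeMonoid.lift (fun k => (X k : Matrix (Fin m) (Fin m) ℂ)) w.1)) P) Y =
        eval (fun w => Matrix.trace (FreeMonoid.lift (fun k => (Y k : Matrix (Fin m) (Fin m) ℂ)) w.1)) P := by
        intro P
        exact aux_aeval_fun _ P Y
      rw [hb, h', Pi.zero_apply, ← h]
      congr 2
      funext i
      cases i with
      | inl w => simp [aux_lift_smul, Matrix.trace_smul]
      | inr k =>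
        simp only [Sum.elim_inr, hq]
        simp [ι, Matrix.det_smul, smul_pow]
    have h := hg (fun w => (FreeMonoid.lift l w.1)⁻¹ * y w)
    rw [hzero, map_zero] at h
    simpa [hd] using h.symm
  -- conclude
  let D : MvPolynomial (W ⊕ Fin r) ℂ := ∏ k, (X (Sum.inr k) - rename (fun j => Sum.inl (ι k j)) q)
  have hD : D ≠ 0 := by
    refine Finset.prod_ne_zero_iff.mpr fun k _ h0 => ?_
    have h := congrArg (eval (Sum.elim (fun _ => 0) (fun _ => eval (fun _ => 0) q + 1))) h0
    rw [map_sub, eval_X, eval_rename, map_zero] at h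
    simp only [Sum.elim_inr, Function.comp_def, Sum.elim_inl] at h
    simp at h
  have hpD : p * D = 0 := by
    apply MvPolynomial.funext
    intro x
    rw [map_mul, map_zero, mul_eq_zero, or_iff_not_imp_right]
    intro hx
    simp only [D, map_prod, map_sub, eval_X, eval_rename, Function.comp_def] at hx
    rw [← ne_eq, Finset.prod_ne_zero_iff] at hx
    have hroot : ∀ k, ∃ l : ℂ, l ^ m = c⁻¹ * (x (Sum.inr k) - eval (fun j => x (Sum.inl (ι k j))) q) :=
      fun k => IsAlgClosed.exists_pow_nat_eq _ (by omega)
    choose l hl using hroot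
    have := key (fun w => x (Sum.inl w)) l (fun k h0 => by
      have h1 := hl k
      rw [h0, zero_pow (by omega)] at h1
      exact mul_ne_zero (inv_ne_zero hc) (hx k (Finset.mem_univ _)) h1.symm)
    rw [← this]
    congr 2
    funext i
    cases i with
    | inl w => rfl
    | inr k => simp [hl, mul_inv_cancel_left₀ hc]
  exact (mul_eq_zero.mp hpD).resolve_right hD
end

section
/- The two functions X ↦ tr(X) and X ↦ tr(X⁻¹) on SL(3,ℂ) are algebraically independent over ℂ, and every conjugation-invariant polynomial function on SL(3,ℂ) lies in the ℂ-subalgebra of functions SL(3,ℂ) → ℂ generated by tr(X) and tr(X⁻¹). -/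
/-- Trace of an element of `SL(3,ℂ)`, as the trace of the underlying matrix. -/
noncomputable def tr3 (X : SL3) : ℂ := Matrix.trace (X : Matrix (Fin 3) (Fin 3) ℂ)

namespace RankOne
open Matrix

/-- Companion matrix with trace `a` and trace of inverse `b`. -/
def comp {R : Type*} [CommRing R] (a b : R) : Matrix (Fin 3) (Fin 3) R :=
  !![0, 0, 1; 1, 0, -b; 0, 1, a]

lemma det_comp (a b : ℂ) : (comp a b).det = 1 := by
  simp [comp, det_fin_three]

/-- The companion matrix as an element of SL3. -/
def compSL (a b : ℂ) : SL3 := ⟨comp a b, det_comp a b⟩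

lemma tr_compSL (a b : ℂ) : tr3 (compSL a b) = a := by
  simp [tr3, compSL, comp, trace_fin_three]

lemma tr_inv_eq (X : SL3) : tr3 X⁻¹ = (adjugate (X : Matrix (Fin 3) (Fin 3) ℂ)).trace := by
  simp [tr3]

lemma tr_inv_compSL (a b : ℂ) : tr3 (compSL a b)⁻¹ = b := by
  rw [tr_inv_eq]
  simp [compSL, comp, adjugate_fin_three, trace_fin_three]

/-- Krylov matrix of the first basis vector. -/
def kry (Y : Matrix (Fin 3) (Fin 3) ℂ) : Matrix (Fin 3) (Fin 3) ℂ :=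
  !![1, Y 0 0, (Y * Y) 0 0; 0, Y 1 0, (Y * Y) 1 0; 0, Y 2 0, (Y * Y) 2 0]

lemma det_kry_smul (c : ℂ) (Y : Matrix (Fin 3) (Fin 3) ℂ) :
    (kry (c • Y)).det = c ^ 3 * (kry Y).det := by
  simp [kry, det_fin_three, Matrix.mul_apply, Fin.sum_univ_three]
  ring

lemma mul_kry (Z : Matrix (Fin 3) (Fin 3) ℂ) (h : Z.det = 1) :
    Z * kry Z = kry Z * comp Z.trace (adjugate Z).trace := by
  rw [det_fin_three] at h
  ext i j
  fin_cases i <;> fin_cases j <;>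
    simp [kry, comp, Matrix.mul_apply, Fin.sum_univ_three, trace_fin_three, adjugate_fin_three]
  · linear_combination h
  · ring
  · ring

lemma conj_comp (Z : SL3) (h : (kry (Z : Matrix (Fin 3) (Fin 3) ℂ)).det ≠ 0) :
    ∃ g : SL3, Z = g * compSL (tr3 Z) (tr3 Z⁻¹) * g⁻¹ := by
  obtain ⟨c, hc⟩ := IsAlgClosed.exists_pow_nat_eq
    ((kry (Z : Matrix (Fin 3) (Fin 3) ℂ)).det⁻¹) (n := 3) (by norm_num)
  have hdet : (c • kry (Z : Matrix (Fin 3) (Fin 3) ℂ)).det = 1 := by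
    rw [det_smul]; simp [hc, h]
  obtain ⟨g, hg⟩ : ∃ g : SL3, (g : Matrix (Fin 3) (Fin 3) ℂ)
      = c • kry (Z : Matrix (Fin 3) (Fin 3) ℂ) := ⟨⟨_, hdet⟩, rfl⟩
  refine ⟨g, ?_⟩
  rw [eq_mul_inv_iff_mul_eq]
  apply Subtype.ext
  have h1 := mul_kry Z Z.2
  have h2 : ((compSL (tr3 Z) (tr3 Z⁻¹) : SL3) : Matrix (Fin 3) (Fin 3) ℂ)
      = comp (trace (Z : Matrix (Fin 3) (Fin 3) ℂ)) (adjugate (Z : Matrix (Fin 3) (Fin 3) ℂ)).trace := by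
    rw [tr_inv_eq]; rfl
  change (Z : Matrix (Fin 3) (Fin 3) ℂ) * (g : Matrix (Fin 3) (Fin 3) ℂ)
    = (g : Matrix (Fin 3) (Fin 3) ℂ) * (compSL (tr3 Z) (tr3 Z⁻¹) : SL3)
  rw [h2, hg, Matrix.mul_smul, Matrix.smul_mul, h1]

lemma key (p : Matrix (Fin 3) (Fin 3) ℂ → ℂ) (q : Matrix (Fin 3) (Fin 3) ℂ → ℂ)
    (hp : Continuous p) (hq : Continuous q)
    (h : ∀ Z : SL3, (kry (Z : Matrix (Fin 3) (Fin 3) ℂ)).det ≠ 0 → p Z = q Z) (X : SL3) :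
    p X = q X := by
  let Y : ℂ → Matrix (Fin 3) (Fin 3) ℂ := fun t => (1 - t) • (X : Matrix (Fin 3) (Fin 3) ℂ)
    + t • comp 0 0
  have hY : Continuous Y := by fun_prop
  have hY0 : Y 0 = X := by simp [Y]
  have hdY : Continuous fun t => (Y t).det := hY.matrix_det
  let c : ℂ → ℂ := fun t => (Y t).det ^ (-(1/3) : ℂ)
  have hc0 : c 0 = 1 := by simp [c, hY0]
  have hc : ContinuousAt c 0 := by
    refine ContinuousAt.cpow hdY.continuousAt continuousAt_const ?_
    simp [hY0]
  let Z : ℂ → Matrix (Fin 3) (Fin 3) ℂ := fun t => c t • Y t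
  have hZ : ContinuousAt Z 0 := hc.smul hY.continuousAt
  have hZ0 : Z 0 = X := by simp [Z, hc0, hY0]
  -- the Krylov determinant is a nonzero polynomial
  obtain ⟨D, hD⟩ : ∃ D : Polynomial ℂ, ∀ t, D.eval t = (kry (Y t)).det := by
    let YP : Matrix (Fin 3) (Fin 3) (Polynomial ℂ) := fun i j =>
      (1 - Polynomial.X) * Polynomial.C ((X : Matrix (Fin 3) (Fin 3) ℂ) i j)
        + Polynomial.X * Polynomial.C (comp 0 0 i j)
    refine ⟨YP 1 0 * (YP * YP) 2 0 - YP 2 0 * (YP * YP) 1 0, fun t => ?_⟩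
    have e : ∀ i j, (YP i j).eval t = Y t i j := by
      intro i j; simp [YP, Y]; ring
    simp [kry, det_fin_three, Matrix.mul_apply, Fin.sum_univ_three, e]
    ring
  have hDne : D ≠ 0 := by
    intro h0
    have := hD 1
    simp [h0, Y, kry, comp, det_fin_three, Matrix.mul_apply, Fin.sum_univ_three] at this
  have ev1 : ∀ᶠ t in nhdsWithin (0 : ℂ) {0}ᶜ, D.eval t ≠ 0 := by
    have hfin : (D.rootSet ℂ \ {0}).Finite := (D.rootSet_finite ℂ).subset Set.sdiff_subset
    have := hfin.isClosed.isOpen_compl.mem_nhds (x := (0 : ℂ)) (by simp)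
    filter_upwards [mem_nhdsWithin_of_mem_nhds this, self_mem_nhdsWithin] with t ht ht0 h0
    exact ht ⟨by simp [Polynomial.mem_rootSet, hDne, h0], ht0⟩
  have ev2 : ∀ᶠ t in nhdsWithin (0 : ℂ) {0}ᶜ, (Y t).det ≠ 0 := by
    apply mem_nhdsWithin_of_mem_nhds
    exact hdY.continuousAt.eventually_ne (by simp [hY0])
  have ev : ∀ᶠ t in nhdsWithin (0 : ℂ) {0}ᶜ, p (Z t) = q (Z t) := by
    filter_upwards [ev1, ev2] with t h1 h2
    have hc3 : c t ^ 3 * (Y t).det = 1 := by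
      have : c t ^ 3 = (Y t).det⁻¹ := by
        simp only [c]
        rw [← Complex.cpow_nat_mul, ← Complex.cpow_neg_one]
        norm_num
      rw [this, inv_mul_cancel₀ h2]
    have hdet : (Z t).det = 1 := by simp [Z, det_smul, hc3]
    refine h ⟨Z t, hdet⟩ ?_
    change (kry (c t • Y t)).det ≠ 0
    rw [det_kry_smul, ← hD]
    exact mul_ne_zero (left_ne_zero_of_mul_eq_one hc3) h1
  have l1 : Filter.Tendsto (fun t => p (Z t)) (nhdsWithin (0 : ℂ) {0}ᶜ) (nhds (p X)) := by
    rw [← hZ0]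
    exact (hp.continuousAt.comp hZ).tendsto.mono_left nhdsWithin_le_nhds
  have l2 : Filter.Tendsto (fun t => q (Z t)) (nhdsWithin (0 : ℂ) {0}ᶜ) (nhds (q X)) := by
    rw [← hZ0]
    exact (hq.continuousAt.comp hZ).tendsto.mono_left nhdsWithin_le_nhds
  exact tendsto_nhds_unique (l1.congr' ev) l2

end RankOne

/-- The functions tr X and tr X⁻¹ on SL(3,ℂ) are algebraically independent over
ℂ, and every conjugation-invariant polynomial function on SL(3,ℂ) is a
polynomial in tr X and tr X⁻¹. -/
theorem rank_one_invariants :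
    AlgebraicIndependent ℂ
      (fun j : Fin 2 => fun X : SL3 => ![tr3 X, tr3 X⁻¹] j) ∧
    ∀ f : SL3 → ℂ,
      (∃ P : MvPolynomial (Fin 3 × Fin 3) ℂ,
        ∀ X : SL3,
          f X = MvPolynomial.eval
            (fun p => (X : Matrix (Fin 3) (Fin 3) ℂ) p.1 p.2) P) →
      (∀ g X : SL3, f (g * X * g⁻¹) = f X) →
      f ∈ Algebra.adjoin ℂ
        ({fun X : SL3 => tr3 X, fun X : SL3 => tr3 X⁻¹} : Set (SL3 → ℂ)) := by
  constructor
  · rw [algebraicIndependent_iff]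
    intro p hp
    apply MvPolynomial.funext
    intro x
    have h1 := congrFun hp (RankOne.compSL (x 0) (x 1))
    have h2 : ∀ X : SL3, (MvPolynomial.aeval
        (fun j : Fin 2 => fun X : SL3 => ![tr3 X, tr3 X⁻¹] j) p) X
        = MvPolynomial.eval ![tr3 X, tr3 X⁻¹] p := by
      intro X
      have := MvPolynomial.comp_aeval_apply
        (fun j : Fin 2 => fun X : SL3 => ![tr3 X, tr3 X⁻¹] j) (Pi.evalAlgHom ℂ (fun _ : SL3 => ℂ) X) p
      simpa [MvPolynomial.aeval_eq_eval] using this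
    rw [h2, RankOne.tr_compSL, RankOne.tr_inv_compSL] at h1
    have hx : ![x 0, x 1] = x := by ext i; fin_cases i <;> rfl
    rw [hx] at h1
    simpa using h1
  · rintro f ⟨P, hP⟩ hf
    let Q : MvPolynomial (Fin 2) ℂ := MvPolynomial.aeval
      (fun p : Fin 3 × Fin 3 => RankOne.comp (MvPolynomial.X 0 : MvPolynomial (Fin 2) ℂ)
        (MvPolynomial.X 1) p.1 p.2) P
    have hQ : ∀ a b : ℂ, MvPolynomial.eval ![a, b] Q = f (RankOne.compSL a b) := by
      intro a b
      rw [hP]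
      have := MvPolynomial.comp_aeval_apply
        (fun p : Fin 3 × Fin 3 => RankOne.comp (MvPolynomial.X 0 : MvPolynomial (Fin 2) ℂ)
        (MvPolynomial.X 1) p.1 p.2) (MvPolynomial.aeval ![a, b]) P
      rw [MvPolynomial.aeval_eq_eval] at this
      refine this.trans ?_
      rw [MvPolynomial.aeval_eq_eval]
      congr 2
      ext ⟨i, j⟩
      fin_cases i <;> fin_cases j <;> simp [RankOne.comp, RankOne.compSL]
    have main : ∀ X : SL3, f X = MvPolynomial.eval ![tr3 X, tr3 X⁻¹] Q := by
      intro X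
      rw [hP, RankOne.tr_inv_eq]
      refine RankOne.key (fun Y => MvPolynomial.eval (fun p => Y p.1 p.2) P)
        (fun Y => MvPolynomial.eval ![Y.trace, Y.adjugate.trace] Q) ?_ ?_ ?_ X
      · exact (MvPolynomial.continuous_eval P).comp (by fun_prop)
      · refine (MvPolynomial.continuous_eval Q).comp (continuous_pi fun i => ?_)
        fin_cases i
        · exact continuous_id.matrix_trace
        · exact continuous_id.matrix_adjugate.matrix_trace
      · intro Z hZ
        obtain ⟨g, hg⟩ := RankOne.conj_comp Z hZ
        have e1 : f Z = f (RankOne.compSL (tr3 Z) (tr3 Z⁻¹)) := by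
          conv_lhs => rw [hg]
          exact hf _ _
        rw [← hQ, hP, RankOne.tr_inv_eq] at e1
        exact e1
    have hfe : f = MvPolynomial.aeval (![fun X : SL3 => tr3 X, fun X : SL3 => tr3 X⁻¹]) Q := by
      funext X
      rw [main]
      have := MvPolynomial.comp_aeval_apply
        (![fun X : SL3 => tr3 X, fun X : SL3 => tr3 X⁻¹]) (Pi.evalAlgHom ℂ (fun _ : SL3 => ℂ) X) Q
      refine Eq.trans ?_ this.symm
      rw [MvPolynomial.aeval_eq_eval]
      congr 2
      ext i
      fin_cases i <;> rfl
    have hr : ({fun X : SL3 => tr3 X, fun X : SL3 => tr3 X⁻¹} : Set (SL3 → ℂ))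
        = Set.range (![fun X : SL3 => tr3 X, fun X : SL3 => tr3 X⁻¹]) := by
      simp [Set.pair_comm]
    rw [hr, Algebra.adjoin_range_eq_range_aeval, hfe]
    exact ⟨Q, rfl⟩
end

section
/- Let A₁, …, A_r ∈ SL(3,ℂ). The tuple (A₁,…,A_r) is reducible (i.e., there exists a linear subspace W of ℂ³ with 0 < dim W < 3 that is invariant under every A_i) if and only if for every choice of six indices i₁,…,i₆ ∈ {1,…,r} (repetitions allowed), the 6-tuple (A_{i₁},…,A_{i₆}) is simultaneously reducible (i.e., there exists a linear subspace W of ℂ³ with 0 < dim W < 3 invariant under A_{i₁},…,A_{i₆}). -/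
/-- A subspace W ⊆ ℂ³ is invariant under A ∈ SL(3,ℂ) if A·W ⊆ W. -/
def InvariantUnder (A : SL3) (W : Submodule ℂ (Fin 3 → ℂ)) : Prop :=
  ∀ v ∈ W, Matrix.mulVec (A : Matrix (Fin 3) (Fin 3) ℂ) v ∈ W

namespace SixTuple

open Module

variable {V : Type*} [AddCommGroup V] [Module ℂ V] [FiniteDimensional ℂ V]

/-- `W` is stable under `T`. -/
def Stab (T : End ℂ V) (W : Submodule ℂ V) : Prop := ∀ v ∈ W, T v ∈ W

/-- In dimension three every non-scalar operator has a polynomial expression of rank one. -/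
theorem exists_rank_one (hV : finrank ℂ V = 3) (T : End ℂ V)
    (hT : ∀ c : ℂ, T ≠ algebraMap ℂ (End ℂ V) c) :
    ∃ X : End ℂ V, X ≠ 0 ∧ finrank ℂ (LinearMap.range X) ≤ 1 ∧
      ∀ W : Submodule ℂ V, Stab T W → Stab X W := by
  have : Nontrivial V := Module.nontrivial_of_finrank_pos (R := ℂ) (by omega)
  obtain ⟨b, hb⟩ := Module.End.exists_eigenvalue T
  by_cases h1 : finrank ℂ (T.eigenspace b) ≤ 1
  · have hroot := Module.End.isRoot_of_hasEigenvalue hb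
    obtain ⟨q, hq⟩ := Polynomial.dvd_iff_isRoot.mpr hroot
    have hm : minpoly ℂ T ≠ 0 := minpoly.ne_zero (Algebra.IsIntegral.isIntegral T)
    have hq0 : q ≠ 0 := by
      rintro rfl
      exact hm (by simpa using hq)
    refine ⟨Polynomial.aeval T q, ?_, ?_, ?_⟩
    · intro h
      have h2 := minpoly.degree_le_of_ne_zero ℂ T hq0 h
      rw [hq, Polynomial.degree_mul, Polynomial.degree_X_sub_C,
        Polynomial.degree_eq_natDegree hq0] at h2
      norm_cast at h2
      omega
    · refine le_trans (Submodule.finrank_mono ?_) h1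
      rintro _ ⟨v, rfl⟩
      rw [Module.End.mem_eigenspace_iff]
      have h3 : Polynomial.aeval T ((Polynomial.X - Polynomial.C b) * q) = 0 := by
        rw [← hq]; exact minpoly.aeval ℂ T
      have h4 := LinearMap.congr_fun h3 v
      rw [map_mul] at h4
      simp [sub_eq_zero] at h4
      exact h4
    · intro W hW v hv
      have key : ∀ p : Polynomial ℂ, ∀ v ∈ W, Polynomial.aeval T p v ∈ W := by
        intro p
        induction p using Polynomial.induction_on' with
        | add p q hp hq =>
          intro v hv
          rw [map_add]
          exact W.add_mem (hp v hv) (hq v hv)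
        | monomial n a =>
          intro v hv
          have hpow : ∀ n : ℕ, (T ^ n) v ∈ W := by
            intro n
            induction n with
            | zero => simpa using hv
            | succ k ih => rw [pow_succ']; exact hW _ ih
          rw [Polynomial.aeval_monomial]
          simpa [Module.algebraMap_end_apply] using W.smul_mem a (hpow n)
      exact key q v hv
  · refine ⟨T - algebraMap ℂ (End ℂ V) b, sub_ne_zero.mpr (hT b), ?_, ?_⟩
    · have h2 := LinearMap.finrank_range_add_finrank_ker (T - algebraMap ℂ (End ℂ V) b)
      rw [Module.End.eigenspace_def, ← Algebra.algebraMap_eq_smul_one] at h1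
      omega
    · intro W hW v hv
      simpa [Module.algebraMap_end_apply] using W.sub_mem (hW v hv) (W.smul_mem b hv)

variable {ι : Type*} (T : ι → End ℂ V)

theorem up_step (hirr : ∀ W : Submodule ℂ V, (∀ i, Stab (T i) W) → W = ⊥ ∨ W = ⊤) (i₀ : ι)
    (U : Submodule ℂ V) (hU : U ≠ ⊥) :
    ∃ (i : ι) (U' : Submodule ℂ V), U' ≠ ⊥ ∧ (finrank ℂ U < finrank ℂ U' ∨ U' = ⊤) ∧
      ∀ W, U ≤ W → Stab (T i) W → U' ≤ W := by
  by_cases hs : ∀ i, Stab (T i) U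
  · have := (hirr U hs).resolve_left hU
    exact ⟨i₀, U, hU, Or.inr this, fun W h _ => h⟩
  · push Not at hs
    obtain ⟨i, hi⟩ := hs
    unfold Stab at hi
    push Not at hi
    obtain ⟨v, hv, hv'⟩ := hi
    refine ⟨i, U ⊔ U.map (T i), ?_, Or.inl ?_, ?_⟩
    · intro h; exact hU (le_bot_iff.mp (h ▸ le_sup_left))
    · apply Submodule.finrank_lt_finrank_of_lt
      refine lt_of_le_of_ne le_sup_left fun h => hv' ?_
      rw [h]
      exact Submodule.mem_sup_right (Submodule.mem_map_of_mem hv)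
    · intro W hW hst
      refine sup_le hW ?_
      rintro _ ⟨u, hu, rfl⟩
      exact hst u (hW hu)

theorem down_step (hirr : ∀ W : Submodule ℂ V, (∀ i, Stab (T i) W) → W = ⊥ ∨ W = ⊤) (i₀ : ι)
    (K : Submodule ℂ V) (hK : K ≠ ⊤) :
    ∃ (i : ι) (K' : Submodule ℂ V), K' ≠ ⊤ ∧ (finrank ℂ K' < finrank ℂ K ∨ K' = ⊥) ∧
      ∀ W, W ≤ K → Stab (T i) W → W ≤ K' := by
  by_cases hs : ∀ i, Stab (T i) K
  · have := (hirr K hs).resolve_right hK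
    exact ⟨i₀, K, hK, Or.inr this, fun W h _ => h⟩
  · push Not at hs
    obtain ⟨i, hi⟩ := hs
    unfold Stab at hi
    push Not at hi
    obtain ⟨v, hv, hv'⟩ := hi
    refine ⟨i, K ⊓ K.comap (T i), ?_, Or.inl ?_, ?_⟩
    · intro h; exact hK (top_le_iff.mp (h ▸ inf_le_left))
    · apply Submodule.finrank_lt_finrank_of_lt
      refine lt_of_le_of_ne inf_le_left fun h => hv' ?_
      rw [← h] at hv
      exact hv.2
    · intro W hW hst u hu
      exact ⟨hW hu, hW (hst u hu)⟩

theorem up (hV : finrank ℂ V = 3)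
    (hirr : ∀ W : Submodule ℂ V, (∀ i, Stab (T i) W) → W = ⊥ ∨ W = ⊤) (i₀ : ι)
    (U : Submodule ℂ V) (hU : U ≠ ⊥) :
    ∃ i j : ι, ∀ W, U ≤ W → Stab (T i) W → Stab (T j) W → W = ⊤ := by
  obtain ⟨i, U₁, h1, h1', h1''⟩ := up_step T hirr i₀ U hU
  obtain ⟨j, U₂, h2, h2', h2''⟩ := up_step T hirr i₀ U₁ h1
  refine ⟨i, j, fun W hW hi hj => ?_⟩
  have hW1 := h1'' W hW hi
  have hW2 := h2'' W hW1 hj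
  rcases h1' with h1' | rfl
  · rcases h2' with h2' | rfl
    · have := Submodule.one_le_finrank_iff.mpr hU
      have := Submodule.finrank_mono hW2
      apply Submodule.eq_top_of_finrank_eq
      have := Submodule.finrank_le W
      omega
    · exact top_le_iff.mp hW2
  · exact top_le_iff.mp hW1

theorem down (hV : finrank ℂ V = 3)
    (hirr : ∀ W : Submodule ℂ V, (∀ i, Stab (T i) W) → W = ⊥ ∨ W = ⊤) (i₀ : ι)
    (K : Submodule ℂ V) (hK : K ≠ ⊤) :
    ∃ i j : ι, ∀ W, W ≤ K → Stab (T i) W → Stab (T j) W → W = ⊥ := by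
  obtain ⟨i, K₁, h1, h1', h1''⟩ := down_step T hirr i₀ K hK
  obtain ⟨j, K₂, h2, h2', h2''⟩ := down_step T hirr i₀ K₁ h1
  refine ⟨i, j, fun W hW hi hj => ?_⟩
  have hW1 := h1'' W hW hi
  have hW2 := h2'' W hW1 hj
  rcases h1' with h1' | rfl
  · rcases h2' with h2' | rfl
    · have := Submodule.finrank_lt hK
      have := Submodule.finrank_mono hW2
      apply Submodule.finrank_eq_zero.mp
      omega
    · exact le_bot_iff.mp hW2
  · exact le_bot_iff.mp hW1

/-- An irreducible family on a three-dimensional space has an irreducible subfamily of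
at most five members. -/
theorem five (hV : finrank ℂ V = 3)
    (hirr : ∀ W : Submodule ℂ V, (∀ i, Stab (T i) W) → W = ⊥ ∨ W = ⊤) (i₀ : ι)
    (hT : ∀ c : ℂ, T i₀ ≠ algebraMap ℂ (End ℂ V) c) :
    ∃ a b c d : ι, ∀ W, Stab (T i₀) W → Stab (T a) W → Stab (T b) W → Stab (T c) W →
      Stab (T d) W → W = ⊥ ∨ W = ⊤ := by
  obtain ⟨X, hX0, hX1, hX⟩ := exists_rank_one hV (T i₀) hT
  obtain ⟨a, b, hab⟩ := up T hV hirr i₀ (LinearMap.range X)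
    (fun h => hX0 (LinearMap.range_eq_bot.mp h))
  obtain ⟨c, d, hcd⟩ := down T hV hirr i₀ (LinearMap.ker X)
    (fun h => hX0 (LinearMap.ker_eq_top.mp h))
  refine ⟨a, b, c, d, fun W h0 ha hb hc hd => ?_⟩
  by_cases hk : W ≤ LinearMap.ker X
  · exact Or.inl (hcd W hk hc hd)
  · right
    refine hab W ?_ ha hb
    obtain ⟨w, hw, hw'⟩ := SetLike.not_le_iff_exists.mp hk
    rw [LinearMap.mem_ker] at hw'
    have hs : Submodule.span ℂ {X w} = LinearMap.range X := by
      apply Submodule.eq_of_le_of_finrank_le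
      · rw [Submodule.span_singleton_le_iff_mem]
        exact LinearMap.mem_range_self X w
      · rw [finrank_span_singleton hw']; exact hX1
    rw [← hs, Submodule.span_singleton_le_iff_mem]
    exact hX W h0 w hw

end SixTuple

/-- A tuple (A₁,…,A_r) in SL(3,ℂ) is reducible (possesses a common nontrivial
proper invariant subspace of ℂ³) if and only if every 6-tuple of its entries
(repetitions allowed) is simultaneously reducible. -/
theorem reducible_iff_all_six_tuples_reducible
    (r : ℕ) (A : Fin r → SL3) :
    (∃ W : Submodule ℂ (Fin 3 → ℂ),
        0 < Module.finrank ℂ W ∧ Module.finrank ℂ W < 3 ∧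
        ∀ i : Fin r, InvariantUnder (A i) W) ↔
    (∀ f : Fin 6 → Fin r, ∃ W : Submodule ℂ (Fin 3 → ℂ),
        0 < Module.finrank ℂ W ∧ Module.finrank ℂ W < 3 ∧
        ∀ j : Fin 6, InvariantUnder (A (f j)) W) := by
  constructor
  · rintro ⟨W, h1, h2, h3⟩ f
    exact ⟨W, h1, h2, fun j => h3 (f j)⟩
  intro h
  have hV : Module.finrank ℂ (Fin 3 → ℂ) = 3 := by simp
  let T : Fin r → Module.End ℂ (Fin 3 → ℂ) :=
    fun i => Matrix.mulVecLin (A i : Matrix (Fin 3) (Fin 3) ℂ)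
  have hTA : ∀ i W, SixTuple.Stab (T i) W ↔ InvariantUnder (A i) W := fun i W => Iff.rfl
  by_cases hsc : ∀ i, ∃ c : ℂ, T i = algebraMap ℂ _ c
  · have he : (Pi.single 0 1 : Fin 3 → ℂ) ≠ 0 := by simp
    refine ⟨Submodule.span ℂ {Pi.single 0 1}, ?_, ?_, ?_⟩
    · rw [finrank_span_singleton he]; norm_num
    · rw [finrank_span_singleton he]; norm_num
    · intro i
      rw [← hTA]
      intro v hv
      obtain ⟨c, hc⟩ := hsc i
      rw [hc, Module.algebraMap_end_apply]
      exact Submodule.smul_mem _ c hv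
  push Not at hsc
  obtain ⟨i₀, hi₀⟩ := hsc
  by_contra hcon
  have hirr : ∀ W : Submodule ℂ (Fin 3 → ℂ), (∀ i, SixTuple.Stab (T i) W) → W = ⊥ ∨ W = ⊤ := by
    intro W hW
    by_contra hne
    push Not at hne
    refine hcon ⟨W, ?_, ?_, hW⟩
    · exact Submodule.one_le_finrank_iff.mpr hne.1
    · have := Submodule.finrank_lt hne.2
      omega
  obtain ⟨a, b, c, d, hfive⟩ := SixTuple.five T hV hirr i₀ hi₀
  obtain ⟨W, h1, h2, h3⟩ := h ![i₀, a, b, c, d, i₀]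
  rcases hfive W (h3 0) (h3 1) (h3 2) (h3 3) (h3 4) with rfl | rfl
  · simp at h1
  · simp at h2
end
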